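/- Let ψ₁:(0,∞)→(0,∞) have a positive continuous derivative, satisfy ψ₁(0⁺)=0, with x ↦ ψ₁(x) and x ↦ x ψ₁′(x) slowly varying at 0⁺, and ψ₁′(s) ∼ 1/(s ℓ(1/s)) as s → 0⁺, where ℓ is slowly varying at infinity. Let ψ be a complete Bernstein function with ψ ∼ a ψ₁ and ψ′ ∼ a ψ₁′ at 0⁺ for some a > 0 and ψ(1)=1, so that c(ψ,n) ≃ 1/((1+n)ℓ(1+n)). Let G be a finitely generated group of polynomial volume growth of degree D and let φ be a finitely supported symmetric probability measure on G with φ(e) > 0 and generating support. Then there are constants c, C ∈ (0,∞) such that for all x ∈ G: c/((1+|x|)^D ℓ(1+|x|²)) ≤ φ_ψ(x) ≤ C/((1+|x|)^D ℓ(1+|x|²)). -/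

import Mathlib

open MeasureTheory Filter Topology Set
open scoped Classical BigOperators

noncomputable section

/-- Word length of `g` with respect to a set `S` of generators. -/
def wordLen {G : Type*} [Group G] (S : Set G) (g : G) : ℕ :=
  sInf {n | ∃ w : List G, (∀ x ∈ w, x ∈ S) ∧ w.length = n ∧ w.prod = g}

/-- The symmetric set associated with a generating tuple. -/
def symSet {G : Type*} [Group G] {k : ℕ} (s : Fin k → G) : Set G :=
  {x | ∃ i, x = s i ∨ x = (s i)⁻¹}

/-- Volume function: number of elements of word length at most `n`. -/
def vol {G : Type*} [Group G] (S : Set G) (n : ℕ) : ℕ :=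
  Set.ncard {g : G | wordLen S g ≤ n}

/-- `S` is a finite symmetric generating set. -/
def IsSymmGen {G : Type*} [Group G] (S : Set G) : Prop :=
  S.Finite ∧ (∀ x ∈ S, x⁻¹ ∈ S) ∧ Subgroup.closure S = ⊤

/-- Polynomial volume growth of degree `D`. -/
def PolyGrowth {G : Type*} [Group G] (S : Set G) (D : ℕ) : Prop :=
  ∃ c C : ℝ, 0 < c ∧ 0 < C ∧ ∀ n : ℕ, 1 ≤ n →
    c * (n : ℝ) ^ D ≤ (vol S n : ℝ) ∧ (vol S n : ℝ) ≤ C * (n : ℝ) ^ D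

/-- A symmetric probability measure on `G`, viewed as a density. -/
def IsSymmProb {G : Type*} [Group G] (μ : G → ℝ) : Prop :=
  (∀ g, 0 ≤ μ g) ∧ Summable μ ∧ (∑' g, μ g) = 1 ∧ (∀ g, μ g⁻¹ = μ g)

/-- Convolution of two densities on `G`. -/
def conv {G : Type*} [Group G] (μ ν : G → ℝ) : G → ℝ :=
  fun g => ∑' h, μ h * ν (h⁻¹ * g)

/-- Convolution powers `μ^{(n)}`. -/
def convPow {G : Type*} [Group G] (μ : G → ℝ) : ℕ → G → ℝ
  | 0 => fun g => if g = 1 then 1 else 0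
  | n + 1 => conv μ (convPow μ n)

/-- Mass a density gives to a set. -/
def massOf {G : Type*} (μ : G → ℝ) (A : Set G) : ℝ := ∑' g : A, μ (g : G)

/-- The weak `ρ`-moment of `μ` is bounded by `M`:
`sup_{s>0} s·μ({g : ρ(|g|) > s}) ≤ M`. -/
def WeakMomentLe {G : Type*} [Group G] (S : Set G) (ρ : ℝ → ℝ) (μ : G → ℝ) (M : ℝ) : Prop :=
  ∀ s : ℝ, 0 < s → s * massOf μ {g | ρ ((wordLen S g : ℝ)) > s} ≤ M

/-- `Φ̃_{G,ρ}(n)`: fastest decay of `φ^{(2n)}(e)` under the weak `ρ`-moment condition. -/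
def PhiTilde {G : Type*} [Group G] (S : Set G) (ρ : ℝ → ℝ) (n : ℕ) : ℝ :=
  sInf {x | ∃ μ : G → ℝ, IsSymmProb μ ∧ WeakMomentLe S ρ μ 2 ∧ x = convPow μ (2 * n) 1}

/-- Slow variation at infinity. -/
def SlowlyVarying (l : ℝ → ℝ) : Prop :=
  ∀ lam : ℝ, 0 < lam → Tendsto (fun x => l (lam * x) / l x) atTop (nhds 1)

/-- `ls` is a de Bruijn conjugate of the slowly varying function `l`. -/
def IsDeBruijnConjugate (l ls : ℝ → ℝ) : Prop :=
  SlowlyVarying ls ∧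
  Tendsto (fun x => l x * ls (x * l x)) atTop (nhds 1) ∧
  Tendsto (fun x => ls x * l (x * ls x)) atTop (nhds 1)

/-- Iterated logarithms: `log_{[0]} x = x`, `log_{[j]} x = log(1 + log_{[j-1]} x)`. -/
def logIter : ℕ → ℝ → ℝ
  | 0, x => x
  | n + 1, x => Real.log (1 + logIter n x)

/-- Base 2 iterated logarithms: `log_{2,1}(s) = log₂(1+s)`, `log_{2,j} = log_{2,1} ∘ log_{2,j-1}`. -/
def log2Iter : ℕ → ℝ → ℝ
  | 0, x => x
  | n + 1, x => Real.logb 2 (1 + log2Iter n x)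

/-- `θ(s) = 1/∫_0^{1/s} dt/(t ℓ(1/t))`. -/
def thetaOf (l : ℝ → ℝ) (s : ℝ) : ℝ :=
  1 / ∫ t in Set.Ioc (0:ℝ) (1/s), 1 / (t * l (1/t))

/-- Dirichlet form `E_μ(f,f) = (1/2) Σ_{x,y} |f(xy)-f(x)|² μ(y)`. -/
def dirichlet {G : Type*} [Group G] (μ : G → ℝ) (f : G → ℝ) : ℝ :=
  (1/2) * ∑' p : G × G, |f (p.1 * p.2) - f p.1| ^ 2 * μ p.2

/-- `f ∈ ℓ²(G)` (counting measure). -/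
def MemL2 {G : Type*} (f : G → ℝ) : Prop := Summable (fun x => (f x) ^ 2)

/-- Bernstein representation `ψ(s) = a + bs + ∫ (1-e^{-st}) dν(t)`,
with `ν` supported in `(0,∞)` and `∫ t/(1+t) dν < ∞`. -/
def IsBernsteinRep (ψ : ℝ → ℝ) (a b : ℝ) (ν : Measure ℝ) : Prop :=
  0 ≤ a ∧ 0 ≤ b ∧ ν (Set.Iic 0) = 0 ∧
  Integrable (fun t => t / (1 + t)) ν ∧
  ∀ s : ℝ, 0 < s → ψ s = a + b * s + ∫ t, (1 - Real.exp (-(s * t))) ∂ν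

/-- Bernstein function (via the classical representation). -/
def IsBernstein (ψ : ℝ → ℝ) : Prop := ∃ a b ν, IsBernsteinRep ψ a b ν

/-- Complete Bernstein function: `ψ(s) = s² ∫_0^∞ e^{-ts} g(t) dt` with `g` Bernstein. -/
def IsCompleteBernstein (ψ : ℝ → ℝ) : Prop :=
  ∃ g : ℝ → ℝ, IsBernstein g ∧
    ∀ s : ℝ, 0 < s → ψ s = s ^ 2 * ∫ t in Set.Ioi (0:ℝ), Real.exp (-(t * s)) * g t

/-- Subordination coefficients `c(ψ,n)` computed from representation data `(b,ν)`:
`c(ψ,1) = b + ∫ t e^{-t} dν`, `c(ψ,n) = (1/n!) ∫ tⁿ e^{-t} dν` for `n > 1`. -/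
def cPsi (b : ℝ) (ν : Measure ℝ) (n : ℕ) : ℝ :=
  if n = 0 then 0
  else (if n = 1 then b else 0) + (1 / (n.factorial : ℝ)) * ∫ t, t ^ n * Real.exp (-t) ∂ν

/-- Subordinated measure `Σ_{n} c(n) φ^{(n)}`. -/
def subord {G : Type*} [Group G] (φ : G → ℝ) (c : ℕ → ℝ) : G → ℝ :=
  fun x => ∑' n : ℕ, c n * convPow φ n x

/-- Tail `H_φ(r) = Σ_{|n|>r} φ(n)` of a measure on `ℤ`. -/
def Hphi (φ : ℤ → ℝ) (r : ℝ) : ℝ := ∑' n : ℤ, if r < (|n| : ℝ) then φ n else 0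

/-- Truncated second moment `G_φ(r) = Σ_{|n|≤r} n² φ(n)`. -/
def Gphi (φ : ℤ → ℝ) (r : ℝ) : ℝ := ∑' n : ℤ, if (|n| : ℝ) ≤ r then (n : ℝ) ^ 2 * φ n else 0

/-- `E_{s,φ}(f,f) = (1/2) Σ_{x∈G} Σ_{n∈ℤ} |f(xsⁿ)-f(x)|² φ(n)`. -/
def EsPhi {G : Type*} [Group G] (s : G) (φ : ℤ → ℝ) (f : G → ℝ) : ℝ :=
  (1/2) * ∑' p : G × ℤ, |f (p.1 * s ^ p.2) - f p.1| ^ 2 * φ p.2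

/-- Symmetric probability measure on `ℤ`. -/
def IsSymmProbZ (φ : ℤ → ℝ) : Prop :=
  (∀ n, 0 ≤ φ n) ∧ Summable φ ∧ (∑' n, φ n) = 1 ∧ (∀ n, φ (-n) = φ n)

/-- Measure supported on powers of generators:
`μ(g) = k⁻¹ Σ_i Σ_{n∈ℤ} w(n) 1_{s_iⁿ}(g)`. -/
def genMeasure {G : Type*} [Group G] {k : ℕ} (s : Fin k → G) (w : ℤ → ℝ) : G → ℝ :=
  fun g => (k : ℝ)⁻¹ * ∑ i : Fin k, ∑' n : ℤ, if g = s i ^ n then w n else 0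

/-- Coefficients in `1-(1-x)^α = Σ_{n≥1} c_α(n) xⁿ`. -/
def cAlpha (a : ℝ) (n : ℕ) : ℝ :=
  if n = 0 then 0
  else (-1) ^ (n + 1) * (∏ j ∈ Finset.range n, (a - j)) / (n.factorial : ℝ)


lemma fs_summable {G : Type*} {f : G → ℝ} (h : (Function.support f).Finite) : Summable f :=
  summable_of_hasFiniteSupport h

lemma fs_of {G : Type*} {f g : G → ℝ} (h : (Function.support f).Finite)
    (h' : ∀ x, f x = 0 → g x = 0) : (Function.support g).Finite :=
  h.subset (fun x hx hf => hx (h' x hf))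

lemma fs_smul {G : Type*} {f g : G → ℝ} (h : (Function.support f).Finite)
    (h' : ∀ x, f x = 0 → g x = 0) : Summable g := fs_summable (fs_of h h')

lemma fs_trans {G : Type*} [Group G] {f : G → ℝ} (h : (Function.support f).Finite) (y : G) :
    (Function.support (fun x => f (y * x))).Finite := by
  have := h.preimage (f := fun x => y * x) (mul_right_injective y).injOn
  exact this

lemma fs_add {G : Type*} {f g : G → ℝ} (hf : (Function.support f).Finite)
    (hg : (Function.support g).Finite) : (Function.support (fun x => |f x| + |g x|)).Finite := by
  refine (hf.union hg).subset ?_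
  intro x hx
  by_contra h
  simp only [mem_union, Function.mem_support, not_or, not_not] at h
  exact hx (by simp [h.1, h.2])

lemma fs_smul2 {G : Type*} {f g k : G → ℝ} (hf : (Function.support f).Finite)
    (hg : (Function.support g).Finite)
    (h' : ∀ x, f x = 0 → g x = 0 → k x = 0) : Summable k := by
  refine fs_smul (fs_add hf hg) ?_
  intro x hx
  have h1 := abs_nonneg (f x)
  have h2 := abs_nonneg (g x)
  exact h' x (abs_eq_zero.1 (by linarith)) (abs_eq_zero.1 (by linarith))

lemma tsum_translate {G : Type*} [Group G] (f : G → ℝ) (y : G) :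
    ∑' x, f (y * x) = ∑' x, f x := (Equiv.mulLeft y).tsum_eq f

lemma cs_tsum {G : Type*} {A B R : G → ℝ} (hA : (Function.support A).Finite)
    (hA0 : ∀ x, 0 ≤ A x) (hB0 : ∀ x, 0 ≤ B x) (hB : Summable B)
    (h : ∀ x, R x ^ 2 ≤ A x * B x) : (∑' x, R x) ^ 2 ≤ (∑' x, A x) * ∑' x, B x := by
  have e1 : ∑' x, R x = ∑ x ∈ hA.toFinset, R x := by
    apply tsum_eq_sum
    intro x hx
    have : A x = 0 := by simpa using hx
    have h2 := h x
    rw [this, zero_mul] at h2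
    exact pow_eq_zero_iff (two_ne_zero) |>.1 (le_antisymm h2 (sq_nonneg _))
  have e2 : ∑' x, A x = ∑ x ∈ hA.toFinset, A x := by
    apply tsum_eq_sum
    intro x hx
    simpa using hx
  rw [e1, e2]
  have := Finset.sum_sq_le_sum_mul_sum_of_sq_le_mul hA.toFinset (r := R) (f := A) (g := B)
    (fun i _ => hA0 i) (fun i _ => hB0 i) (fun i _ => h i)
  refine this.trans ?_
  gcongr
  · exact Finset.sum_nonneg (fun i _ => hA0 i)
  · exact hB.sum_le_tsum _ (fun i _ => hB0 i)

section cp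
variable {G : Type*} [Group G] {φ : G → ℝ}

lemma conv_eq (hF : (Function.support φ).Finite) (f : G → ℝ) (x : G) :
    conv φ f x = ∑ s ∈ hF.toFinset, φ s * f (s⁻¹ * x) := by
  unfold conv
  apply tsum_eq_sum
  intro s hs
  have : φ s = 0 := by simpa using hs
  simp [this]

lemma sum_phi (hF : (Function.support φ).Finite) (hφ : IsSymmProb φ) :
    ∑ s ∈ hF.toFinset, φ s = 1 := by
  rw [← hφ.2.2.1]
  symm
  apply tsum_eq_sum
  intro s hs
  simpa using hs

lemma conv_fs (hF : (Function.support φ).Finite) {f : G → ℝ} (hf : (Function.support f).Finite) :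
    (Function.support (conv φ f)).Finite := by
  refine (hF.mul hf).subset ?_
  intro x hx
  rw [Function.mem_support, conv_eq hF] at hx
  obtain ⟨s, hs, h⟩ := Finset.exists_ne_zero_of_sum_ne_zero hx
  refine Set.mem_mul.2 ⟨s, left_ne_zero_of_mul h, s⁻¹ * x, right_ne_zero_of_mul h, by simp⟩

lemma cp_fs (hF : (Function.support φ).Finite) (n : ℕ) :
    (Function.support (convPow φ n)).Finite := by
  induction n with
  | zero =>
    refine (Set.finite_singleton (1 : G)).subset ?_
    intro x hx
    by_contra h
    exact hx (by simpa [convPow] using h)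
  | succ n ih => exact conv_fs hF ih

lemma cp_nonneg (hφ : IsSymmProb φ) (n : ℕ) (x : G) : 0 ≤ convPow φ n x := by
  induction n generalizing x with
  | zero => simp only [convPow]; split_ifs <;> norm_num
  | succ n ih => exact tsum_nonneg (fun h => mul_nonneg (hφ.1 _) (ih _))

lemma cp_sum (hF : (Function.support φ).Finite) (hφ : IsSymmProb φ) (n : ℕ) :
    ∑' x, convPow φ n x = 1 := by
  induction n with
  | zero => simp [convPow]
  | succ n ih =>
    have : ∀ x, convPow φ (n+1) x = ∑ s ∈ hF.toFinset, φ s * convPow φ n (s⁻¹ * x) :=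
      fun x => conv_eq hF _ x
    simp_rw [this]
    rw [Summable.tsum_finsetSum]
    · simp_rw [tsum_mul_left, tsum_translate (convPow φ n), ih, mul_one]
      exact sum_phi hF hφ
    · intro s _
      exact (fs_summable (fs_trans (cp_fs hF n) _)).mul_left _

lemma cp_add (hF : (Function.support φ).Finite) (m n : ℕ) (x : G) :
    convPow φ (m + n) x = ∑' y, convPow φ m y * convPow φ n (y⁻¹ * x) := by
  induction m generalizing x with
  | zero =>
    rw [tsum_eq_single (1:G)]
    · simp [convPow]
    · intro y hy; simp [convPow, hy]
  | succ m ih =>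
    have e : m + 1 + n = (m + n) + 1 := by ring
    rw [e]
    have h1 : convPow φ (m+n+1) x = ∑ s ∈ hF.toFinset, φ s * convPow φ (m+n) (s⁻¹ * x) :=
      conv_eq hF _ x
    have h2 : ∀ y, convPow φ (m+1) y = ∑ s ∈ hF.toFinset, φ s * convPow φ m (s⁻¹ * y) :=
      fun y => conv_eq hF _ y
    rw [h1]
    simp_rw [h2, ih, Finset.sum_mul]
    rw [Summable.tsum_finsetSum]
    · refine Finset.sum_congr rfl (fun s _ => ?_)
      rw [← tsum_mul_left]
      rw [← tsum_translate (fun y => φ s * (convPow φ m y * convPow φ n (y⁻¹ * (s⁻¹ * x)))) s⁻¹]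
      refine tsum_congr (fun y => ?_)
      have : (s⁻¹ * y)⁻¹ * (s⁻¹ * x) = y⁻¹ * x := by group
      rw [this]; ring
    · intro s _
      refine fs_smul (fs_trans (cp_fs hF m) s⁻¹) ?_
      intro y hy
      rw [hy]; ring

lemma cp_one (x : G) : convPow φ 1 x = φ x := by
  have : convPow φ 1 x = conv φ (convPow φ 0) x := rfl
  rw [this, conv, tsum_eq_single x]
  · simp [convPow]
  · intro y hy
    have : y⁻¹ * x ≠ 1 := by
      intro h; exact hy (inv_mul_eq_one.1 h)
    simp [convPow, this]

lemma cp_symm (hF : (Function.support φ).Finite) (hφ : IsSymmProb φ) (n : ℕ) (x : G) :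
    convPow φ n x⁻¹ = convPow φ n x := by
  induction n generalizing x with
  | zero => simp [convPow]
  | succ n ih =>
    rw [cp_add hF n 1]
    have : convPow φ (n+1) x = ∑' y, φ y * convPow φ n (y⁻¹ * x) := rfl
    rw [this]
    rw [← tsum_translate (fun y => convPow φ n y * convPow φ 1 (y⁻¹ * x⁻¹)) x⁻¹]
    refine tsum_congr (fun y => ?_)
    rw [cp_one]
    have e1 : (x⁻¹ * y)⁻¹ * x⁻¹ = y⁻¹ := by group
    have e2 : x⁻¹ * y = (y⁻¹ * x)⁻¹ := by group
    rw [e1, hφ.2.2.2, e2, ih, mul_comm]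

end cp


/-- squared left gradient in direction `y` -/
def Ng {G : Type*} [Group G] (f : G → ℝ) (y : G) : ℝ := ∑' x, (f (y * x) - f x) ^ 2

lemma Ng_nonneg {G : Type*} [Group G] (f : G → ℝ) (y : G) : 0 ≤ Ng f y :=
  tsum_nonneg (fun _ => sq_nonneg _)

lemma Ng_summable {G : Type*} [Group G] {f : G → ℝ} (hf : (Function.support f).Finite) (y : G) :
    Summable (fun x => (f (y * x) - f x) ^ 2) :=
  fs_smul2 (fs_trans hf y) hf (fun x h1 h2 => by rw [h1, h2]; ring)

lemma var_ineq {G : Type*} [Group G] {φ : G → ℝ} (hF : (Function.support φ).Finite)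
    (hφ : IsSymmProb φ) (hφe : 0 < φ 1) (f : G → ℝ) (x : G) :
    (conv φ f x) ^ 2 ≤ ∑ s ∈ hF.toFinset, φ s * (f (s⁻¹ * x) ^ 2
      - φ 1 * (f (s⁻¹ * x) - f x) ^ 2) := by
  rw [conv_eq hF]
  have h1 := sum_phi hF hφ
  have hmem : (1:G) ∈ hF.toFinset := by simpa using hφe.ne'
  set F := hF.toFinset
  set v : G → ℝ := fun s => f (s⁻¹ * x) - f x with hv
  have hv1 : v 1 = 0 := by simp [hv]
  have e1 : ∑ s ∈ F, φ s * f (s⁻¹ * x) = ∑ s ∈ F, φ s * v s + f x := by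
    have : ∀ s, φ s * f (s⁻¹ * x) = φ s * v s + φ s * f x := by intro s; simp only [hv]; ring
    simp_rw [this]
    rw [Finset.sum_add_distrib, ← Finset.sum_mul, h1, one_mul]
  have e2 : ∑ s ∈ F, φ s * (f (s⁻¹ * x) ^ 2 - φ 1 * (f (s⁻¹ * x) - f x) ^ 2)
      = (1 - φ 1) * ∑ s ∈ F, φ s * v s ^ 2 + 2 * f x * ∑ s ∈ F, φ s * v s + f x ^ 2 := by
    have : ∀ s, φ s * (f (s⁻¹ * x) ^ 2 - φ 1 * (f (s⁻¹ * x) - f x) ^ 2) =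
      (1 - φ 1) * (φ s * v s ^ 2) + 2 * f x * (φ s * v s) + φ s * f x ^ 2 := by
      intro s; simp only [hv]; ring
    simp_rw [this]
    rw [Finset.sum_add_distrib, Finset.sum_add_distrib, ← Finset.sum_mul, h1, one_mul,
      Finset.mul_sum, Finset.mul_sum]
  have e3 : (∑ s ∈ F, φ s * v s) ^ 2 ≤ (1 - φ 1) * ∑ s ∈ F, φ s * v s ^ 2 := by
    have a1 : ∑ s ∈ F.erase 1, φ s * v s = ∑ s ∈ F, φ s * v s := by
      rw [← Finset.add_sum_erase F _ hmem, hv1]; ring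
    have a2 : ∑ s ∈ F.erase 1, φ s * v s ^ 2 = ∑ s ∈ F, φ s * v s ^ 2 := by
      rw [← Finset.add_sum_erase F _ hmem, hv1]; ring
    have a3 : ∑ s ∈ F.erase 1, φ s = 1 - φ 1 := by
      rw [← h1, ← Finset.add_sum_erase F _ hmem]; ring
    rw [← a1, ← a2, ← a3]
    apply Finset.sum_sq_le_sum_mul_sum_of_sq_le_mul
    · intro i _; exact hφ.1 i
    · intro i _; exact mul_nonneg (hφ.1 i) (sq_nonneg _)
    · intro i _; apply le_of_eq; ring
  rw [e1, e2]
  nlinarith [e3]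

/-- energy -/
def En {G : Type*} [Group G] {φ : G → ℝ} (hF : (Function.support φ).Finite) (f : G → ℝ) : ℝ :=
  ∑ s ∈ hF.toFinset, φ s * Ng f s⁻¹

lemma dissip {G : Type*} [Group G] {φ : G → ℝ} (hF : (Function.support φ).Finite)
    (hφ : IsSymmProb φ) (hφe : 0 < φ 1) {f : G → ℝ} (hf : (Function.support f).Finite) :
    ∑' x, (conv φ f x) ^ 2 + φ 1 * En hF f ≤ ∑' x, f x ^ 2 := by
  have hs1 : ∀ s, Summable (fun x => f (s * x) ^ 2) := fun s =>
    fs_smul (fs_trans hf s) (fun x h => by rw [h]; ring)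
  have hsum : ∀ s, Summable (fun x => φ s * (f (s⁻¹ * x) ^ 2
      - φ 1 * (f (s⁻¹ * x) - f x) ^ 2)) := fun s =>
    ((hs1 _).sub ((Ng_summable hf s⁻¹).mul_left _)).mul_left _
  have h1 : ∑' x, (conv φ f x) ^ 2 ≤ ∑' x, ∑ s ∈ hF.toFinset, φ s * (f (s⁻¹ * x) ^ 2
      - φ 1 * (f (s⁻¹ * x) - f x) ^ 2) := by
    apply Summable.tsum_le_tsum (fun x => var_ineq hF hφ hφe f x)
    · exact fs_smul (conv_fs hF hf) (fun x h => by rw [h]; ring)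
    · exact summable_sum (fun s _ => hsum s)
  rw [Summable.tsum_finsetSum (fun s _ => hsum s)] at h1
  have h2 : ∀ s, ∑' x, φ s * (f (s⁻¹ * x) ^ 2 - φ 1 * (f (s⁻¹ * x) - f x) ^ 2)
      = φ s * (∑' x, f x ^ 2) - φ 1 * (φ s * Ng f s⁻¹) := by
    intro s
    rw [tsum_mul_left, Summable.tsum_sub (hs1 _) ((Ng_summable hf s⁻¹).mul_left _), tsum_mul_left,
      tsum_translate (fun x => f x ^ 2)]
    unfold Ng
    ring
  simp_rw [h2] at h1
  rw [Finset.sum_sub_distrib, ← Finset.sum_mul, sum_phi hF hφ, ← Finset.mul_sum] at h1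
  unfold En
  linarith

lemma sum_inv {G : Type*} [Group G] {φ : G → ℝ} (hF : (Function.support φ).Finite)
    (hφ : IsSymmProb φ) (T : G → ℝ) :
    ∑ s ∈ hF.toFinset, φ s * T s⁻¹ = ∑ s ∈ hF.toFinset, φ s * T s := by
  apply Finset.sum_nbij' (fun s => s⁻¹) (fun s => s⁻¹)
  · intro s hs; simpa [hφ.2.2.2] using hs
  · intro s hs; simpa [hφ.2.2.2] using hs
  · simp
  · simp
  · intro s _; rw [hφ.2.2.2]

lemma wcontr {G : Type*} [Group G] {φ : G → ℝ} (hF : (Function.support φ).Finite)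
    (hφ : IsSymmProb φ) (hφe : 0 < φ 1) {f : G → ℝ} (hf : (Function.support f).Finite)
    (W : G → ℝ) (hW : ∀ x, 0 ≤ W x) (d : ℝ) (hd0 : 0 ≤ d) (hd : d ≤ φ 1)
    (hWd : ∀ s ∈ hF.toFinset, ∀ x, |W x - W (s⁻¹ * x)| ≤ d * W x) :
    ∑' x, W x * (conv φ f x) ^ 2 ≤ (1 + d ^ 2 / φ 1) * ∑' x, W x * f x ^ 2 := by
  have hs1 : ∀ (V : G → ℝ) s, Summable (fun x => V x * f (s * x) ^ 2) := fun V s =>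
    fs_smul (fs_trans hf s) (fun x h => by rw [h]; ring)
  have hs0 : ∀ (V : G → ℝ), Summable (fun x => V x * f x ^ 2) := fun V =>
    fs_smul hf (fun x h => by rw [h]; ring)
  have hN : ∀ s, Summable (fun x => W x * (f (s * x) - f x) ^ 2) := fun y =>
    fs_smul2 (fs_trans hf y) hf (fun x h1 h2 => by rw [h1, h2]; ring)
  set Nw : G → ℝ := fun s => ∑' x, W x * (f (s⁻¹ * x) - f x) ^ 2 with hNw
  set I := ∑' x, W x * f x ^ 2 with hI
  set A : G → ℝ := fun s => ∑' x, W x * f (s⁻¹ * x) ^ 2 with hA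
  have step1 : ∑' x, W x * (conv φ f x) ^ 2 ≤
      ∑ s ∈ hF.toFinset, φ s * (A s - φ 1 * Nw s) := by
    have hsum : ∀ s, Summable (fun x => φ s * (W x * f (s⁻¹ * x) ^ 2
      - φ 1 * (W x * (f (s⁻¹ * x) - f x) ^ 2))) := fun s =>
      ((hs1 W _).sub ((hN s⁻¹).mul_left _)).mul_left _
    have h1 : ∑' x, W x * (conv φ f x) ^ 2 ≤ ∑' x, ∑ s ∈ hF.toFinset, φ s * (W x * f (s⁻¹ * x) ^ 2
      - φ 1 * (W x * (f (s⁻¹ * x) - f x) ^ 2)) := by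
      apply Summable.tsum_le_tsum
      · intro x
        have := mul_le_mul_of_nonneg_left (var_ineq hF hφ hφe f x) (hW x)
        refine this.trans (le_of_eq ?_)
        rw [Finset.mul_sum]
        refine Finset.sum_congr rfl (fun s _ => by ring)
      · exact fs_smul (conv_fs hF hf) (fun x h => by rw [h]; ring)
      · exact summable_sum (fun s _ => hsum s)
    rw [Summable.tsum_finsetSum (fun s _ => hsum s)] at h1
    refine h1.trans (le_of_eq (Finset.sum_congr rfl (fun s _ => ?_)))
    rw [tsum_mul_left, Summable.tsum_sub (hs1 W _) ((hN s⁻¹).mul_left _), tsum_mul_left]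
  have step2 : ∀ s ∈ hF.toFinset, A s + A s⁻¹ - 2 * I ≤ 2 * φ 1 * Nw s + d ^ 2 / φ 1 * I := by
    intro s hs
    have e1 : A s⁻¹ = ∑' x, W (s⁻¹ * x) * f x ^ 2 := by
      simp only [hA, inv_inv]
      rw [← tsum_translate (fun x => W x * f (s * x) ^ 2) s⁻¹]
      refine tsum_congr (fun x => by rw [mul_inv_cancel_left])
    have e2 : I = ∑' x, W (s⁻¹ * x) * f (s⁻¹ * x) ^ 2 := by
      rw [hI, ← tsum_translate (fun x => W x * f x ^ 2) s⁻¹]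
    have e3 : A s + A s⁻¹ - 2 * I = ∑' x, (W x * f (s⁻¹ * x) ^ 2 + W (s⁻¹ * x) * f x ^ 2
        - (W x * f x ^ 2 + W (s⁻¹ * x) * f (s⁻¹ * x) ^ 2)) := by
      rw [Summable.tsum_sub ((hs1 W _).add (hs0 _)) ((hs0 W).add (hs1 (fun x => W (s⁻¹ * x)) _)),
        Summable.tsum_add (hs1 W _) (hs0 _),
        Summable.tsum_add (hs0 W) (hs1 (fun x => W (s⁻¹ * x)) _), ← e1, ← e2]
      ring
    rw [e3]
    have e4 : 2 * φ 1 * Nw s + d ^ 2 / φ 1 * I = ∑' x, (2 * φ 1 * (W x * (f (s⁻¹ * x) - f x) ^ 2)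
        + d ^ 2 / φ 1 * (W x * f x ^ 2)) := by
      rw [Summable.tsum_add ((hN _).mul_left _) ((hs0 W).mul_left _), tsum_mul_left, tsum_mul_left]
    rw [e4]
    apply Summable.tsum_le_tsum
    · intro x
      set u := f x
      set D := f (s⁻¹ * x) - f x with hD
      have hu : f (s⁻¹ * x) = D + u := by simp [hD, u]
      rw [hu]
      have h := hWd s hs x
      set w := W x
      set w' := W (s⁻¹ * x)
      have hw : 0 ≤ w := hW x
      have q1 : w * (D + u) ^ 2 + w' * u ^ 2 - (w * u ^ 2 + w' * (D + u) ^ 2)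
        = (w - w') * (D ^ 2 + 2 * D * u) := by ring
      rw [q1]
      have q2 : (w - w') * (D ^ 2 + 2 * D * u) ≤ d * w * (D ^ 2 + 2 * |D| * |u|) := by
        refine (le_abs_self _).trans ?_
        rw [abs_mul]
        apply mul_le_mul h _ (abs_nonneg _) (by positivity)
        refine (abs_add_le _ _).trans ?_
        rw [abs_mul, abs_mul, abs_of_nonneg (sq_nonneg D), abs_two]
      refine q2.trans ?_
      have q3 : d * (D ^ 2 + 2 * |D| * |u|) ≤ 2 * φ 1 * D ^ 2 + d ^ 2 / φ 1 * u ^ 2 := by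
        have r1 : d * D ^ 2 ≤ φ 1 * D ^ 2 := by gcongr
        have r2 : 2 * d * |D| * |u| ≤ φ 1 * D ^ 2 + d ^ 2 / φ 1 * u ^ 2 := by
          have : 0 ≤ φ 1 * (|D| - d / φ 1 * |u|) ^ 2 := by positivity
          have e : φ 1 * (|D| - d / φ 1 * |u|) ^ 2 =
            φ 1 * |D| ^ 2 + d ^ 2 / φ 1 * |u| ^ 2 - 2 * d * |D| * |u| := by
            field_simp
            ring
          rw [e, sq_abs, sq_abs] at this
          linarith
        nlinarith
      nlinarith [mul_le_mul_of_nonneg_left q3 hw]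
    · exact ((hs1 W _).add (hs0 _)).sub ((hs0 W).add (hs1 (fun x => W (s⁻¹ * x)) _))
    · exact ((hN _).mul_left _).add ((hs0 W).mul_left _)
  have hI0 : 0 ≤ I := tsum_nonneg (fun x => mul_nonneg (hW x) (sq_nonneg _))
  have step3 : ∑ s ∈ hF.toFinset, φ s * (A s + A s⁻¹ - 2 * I) ≤
      ∑ s ∈ hF.toFinset, φ s * (2 * φ 1 * Nw s + d ^ 2 / φ 1 * I) :=
    Finset.sum_le_sum (fun s hs => mul_le_mul_of_nonneg_left (step2 s hs) (hφ.1 s))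
  have e5 : ∑ s ∈ hF.toFinset, φ s * (A s + A s⁻¹ - 2 * I) =
      2 * ∑ s ∈ hF.toFinset, φ s * A s - 2 * I := by
    have : ∀ s, φ s * (A s + A s⁻¹ - 2 * I) = φ s * A s + φ s * A s⁻¹ - φ s * (2 * I) := by
      intro s; ring
    simp_rw [this]
    rw [Finset.sum_sub_distrib, Finset.sum_add_distrib, sum_inv hF hφ A, ← Finset.sum_mul,
      sum_phi hF hφ]
    ring
  have e6 : ∑ s ∈ hF.toFinset, φ s * (2 * φ 1 * Nw s + d ^ 2 / φ 1 * I) =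
      2 * φ 1 * ∑ s ∈ hF.toFinset, φ s * Nw s + d ^ 2 / φ 1 * I := by
    have : ∀ s, φ s * (2 * φ 1 * Nw s + d ^ 2 / φ 1 * I) = 2 * φ 1 * (φ s * Nw s) +
      φ s * (d ^ 2 / φ 1 * I) := by
      intro s; ring
    simp_rw [this]
    rw [Finset.sum_add_distrib, ← Finset.mul_sum, ← Finset.sum_mul, sum_phi hF hφ]
    ring
  have e7 : ∑ s ∈ hF.toFinset, φ s * (A s - φ 1 * Nw s) =
      ∑ s ∈ hF.toFinset, φ s * A s - φ 1 * ∑ s ∈ hF.toFinset, φ s * Nw s := by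
    rw [Finset.mul_sum, ← Finset.sum_sub_distrib]
    exact Finset.sum_congr rfl (fun s _ => by ring)
  rw [e5, e6] at step3
  rw [e7] at step1
  have : 0 ≤ d ^ 2 / φ 1 * I := by positivity
  linarith

lemma Ng_word {G : Type*} [Group G] {f : G → ℝ} (hf : (Function.support f).Finite)
    (T : Set G) (M : ℝ) (hM : ∀ t ∈ T, Ng f t ≤ M) (w : List G) (hw : ∀ x ∈ w, x ∈ T) :
    Ng f w.prod ≤ (w.length : ℝ) ^ 2 * M := by
  induction w with
  | nil => simp [Ng]
  | cons t w ih =>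
    have ih := ih (fun x hx => hw x (List.mem_cons_of_mem _ hx))
    have ht := hM t (hw t List.mem_cons_self)
    rcases Nat.eq_zero_or_pos w.length with h0 | h0
    · have : w = [] := List.length_eq_zero_iff.1 h0
      subst this
      simpa using ht
    · set k : ℝ := (w.length : ℝ) with hk
      have hkpos : 0 < k := by rw [hk]; exact_mod_cast h0
      set y := w.prod
      have hS1 : Summable (fun x => (f (t * (y * x)) - f (y * x)) ^ 2) :=
        fs_smul2 (fs_trans (fs_trans hf t) y) (fs_trans hf y)
          (fun x h1 h2 => by rw [h1, h2]; ring)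
      have hS2 := Ng_summable hf y
      have e : Ng f (t * y) ≤ (1 + k) * Ng f t + (1 + 1 / k) * Ng f y := by
        have e1 : Ng f t = ∑' x, (f (t * (y * x)) - f (y * x)) ^ 2 := by
          unfold Ng
          rw [← tsum_translate (fun x => (f (t * x) - f x) ^ 2) y]
        rw [e1]
        unfold Ng
        rw [← tsum_mul_left, ← tsum_mul_left, ← Summable.tsum_add (hS1.mul_left _) (hS2.mul_left _)]
        apply Summable.tsum_le_tsum _ (Ng_summable hf _) ((hS1.mul_left _).add (hS2.mul_left _))
        intro x
        rw [mul_assoc]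
        set p := f (t * (y * x))
        set q := f (y * x)
        set r := f x
        have : 0 ≤ (k * (p - q) - (q - r)) ^ 2 / k := by positivity
        have e2 : (1 + k) * (p - q) ^ 2 + (1 + 1 / k) * (q - r) ^ 2 - (p - r) ^ 2
          = (k * (p - q) - (q - r)) ^ 2 / k := by
          field_simp
          ring
        linarith
      rw [List.prod_cons, List.length_cons]
      push_cast
      rw [← hk]
      refine e.trans ?_
      have h1 : (1 + k) * Ng f t ≤ (1 + k) * M := by gcongr
      have h2 : (1 + 1 / k) * Ng f y ≤ (1 + 1 / k) * (k ^ 2 * M) := by gcongr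
      have h3 : (1 + 1 / k) * (k ^ 2 * M) = k ^ 2 * M + k * M := by field_simp
      nlinarith

lemma nash_aux {G : Type*} [Group G] {f : G → ℝ} (hf : (Function.support f).Finite)
    (hf0 : ∀ x, 0 ≤ f x) (hf1 : ∑' x, f x = 1) (B : Finset G) (hB : B.Nonempty) (M : ℝ)
    (hM : ∀ y ∈ B, Ng f y ≤ M) : ∑' x, f x ^ 2 ≤ M + 1 / (B.card : ℝ) := by
  have hs1 : ∀ y, Summable (fun x => f x * f (y * x)) := fun y =>
    fs_smul hf (fun x h => by rw [h]; ring)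
  have hs2 : Summable (fun x => f x ^ 2) := fs_smul hf (fun x h => by rw [h]; ring)
  have hs3 : ∀ y, Summable (fun x => f (y * x) ^ 2) := fun y =>
    fs_smul (fs_trans hf y) (fun x h => by rw [h]; ring)
  have key : ∀ y, Ng f y = 2 * ∑' x, f x ^ 2 - 2 * ∑' x, f x * f (y * x) := by
    intro y
    unfold Ng
    have : ∀ x, (f (y * x) - f x) ^ 2 = (f (y * x) ^ 2 + f x ^ 2) - 2 * (f x * f (y * x)) := by
      intro x; ring
    simp_rw [this]
    rw [Summable.tsum_sub ((hs3 y).add hs2) ((hs1 y).mul_left _), Summable.tsum_add (hs3 y) hs2,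
      tsum_mul_left, tsum_translate (fun x => f x ^ 2)]
    ring
  have h2 : ∑ y ∈ B, ∑' x, f x * f (y * x) ≤ 1 := by
    rw [← Summable.tsum_finsetSum (fun y _ => hs1 y)]
    rw [← hf1]
    apply Summable.tsum_le_tsum _ (summable_sum (fun y _ => hs1 y)) (fs_summable hf)
    intro x
    rw [← Finset.mul_sum]
    have : ∑ y ∈ B, f (y * x) ≤ 1 := by
      rw [← hf1, ← (Equiv.mulRight x).tsum_eq f]
      apply Summable.sum_le_tsum B (fun i _ => hf0 _)
      exact (Equiv.mulRight x).summable_iff.2 (fs_summable hf)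
    exact mul_le_of_le_one_right (hf0 x) this
  have h3 : ∑ y ∈ B, Ng f y ≤ B.card * M := by
    have := Finset.sum_le_sum hM
    simpa using this
  have hc : (0:ℝ) < B.card := by exact_mod_cast hB.card_pos
  have h4 : ∑ y ∈ B, Ng f y = B.card * (2 * ∑' x, f x ^ 2) - 2 * ∑ y ∈ B, ∑' x, f x * f (y * x) := by
    simp_rw [key]
    rw [Finset.sum_sub_distrib, Finset.mul_sum B]
    simp
  have hM0 : 0 ≤ M := by
    obtain ⟨y, hy⟩ := hB
    exact (Ng_nonneg f y).trans (hM y hy)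
  have h5 : B.card * (∑' x, f x ^ 2) ≤ B.card * (M + 1 / B.card) := by
    have : (B.card:ℝ) * (M + 1 / B.card) = B.card * M + 1 := by field_simp
    rw [this]
    have : 0 ≤ (B.card:ℝ) * M := by positivity
    linarith
  exact le_of_mul_le_mul_left h5 hc


lemma gen_word {G : Type*} [Group G] {T : Set G} (hT : ∀ x ∈ T, x⁻¹ ∈ T)
    (hc : Subgroup.closure T = ⊤) (g : G) : ∃ w : List G, (∀ x ∈ w, x ∈ T) ∧ w.prod = g := by
  have h1 : T ∪ T⁻¹ = T := by
    apply Set.union_eq_self_of_subset_right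
    intro x hx
    have := hT _ (Set.mem_inv.1 hx)
    simpa using this
  have h2 : g ∈ (Subgroup.closure T).toSubmonoid := by rw [hc]; trivial
  rw [Subgroup.closure_toSubmonoid, h1] at h2
  exact Submonoid.exists_list_of_mem_closure h2

lemma wl_spec {G : Type*} [Group G] {S : Set G} (hS : IsSymmGen S) (g : G) :
    ∃ w : List G, (∀ x ∈ w, x ∈ S) ∧ w.length = wordLen S g ∧ w.prod = g := by
  have : {n | ∃ w : List G, (∀ x ∈ w, x ∈ S) ∧ w.length = n ∧ w.prod = g}.Nonempty := by
    obtain ⟨w, h1, h2⟩ := gen_word hS.2.1 hS.2.2 g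
    exact ⟨_, w, h1, rfl, h2⟩
  exact Nat.sInf_mem this

lemma wl_mul {G : Type*} [Group G] {S : Set G} (hS : IsSymmGen S) (g h : G) :
    wordLen S (g * h) ≤ wordLen S g + wordLen S h := by
  obtain ⟨w, h1, h2, h3⟩ := wl_spec hS g
  obtain ⟨v, k1, k2, k3⟩ := wl_spec hS h
  apply Nat.sInf_le
  refine ⟨w ++ v, ?_, ?_, ?_⟩
  · intro x hx
    rcases List.mem_append.1 hx with h | h
    · exact h1 x h
    · exact k1 x h
  · simp [h2, k2]
  · simp [h3, k3]

lemma wl_one {G : Type*} [Group G] {S : Set G} : wordLen S (1:G) = 0 := by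
  apply Nat.le_zero.1
  apply Nat.sInf_le
  exact ⟨[], by simp, rfl, rfl⟩

lemma grad_bound {G : Type*} [Group G] {S : Set G} (hS : IsSymmGen S) {φ : G → ℝ}
    (hF : (Function.support φ).Finite) (hφ : IsSymmProb φ)
    (hφgen : Subgroup.closure (Function.support φ) = ⊤) :
    ∃ C : ℝ, 0 < C ∧ ∀ f : G → ℝ, (Function.support f).Finite → ∀ y,
      Ng f y ≤ C * (wordLen S y : ℝ) ^ 2 * En hF f := by
  have hw : ∀ s : G, ∃ w : List G, (∀ x ∈ w, x ∈ Function.support φ) ∧ w.prod = s :=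
    gen_word (fun x hx => by rw [Function.mem_support] at *; rwa [hφ.2.2.2]) hφgen
  choose w hw1 hw2 using hw
  set K := ∑ s ∈ hF.toFinset, 1 / φ s with hK
  have hK0 : 0 ≤ K := Finset.sum_nonneg (fun s _ => one_div_nonneg.2 (hφ.1 s))
  set K' := ∑ s ∈ hS.1.toFinset, ((w s).length : ℝ) ^ 2 with hK'
  have hK'0 : 0 ≤ K' := Finset.sum_nonneg (fun s _ => sq_nonneg _)
  refine ⟨K' * K + 1, by positivity, ?_⟩
  intro f hf y
  have hE0 : 0 ≤ En hF f :=
    Finset.sum_nonneg (fun s _ => mul_nonneg (hφ.1 s) (Ng_nonneg _ _))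
  have h1 : ∀ t ∈ Function.support φ, Ng f t ≤ K * En hF f := by
    intro t ht
    have htpos : 0 < φ t := lt_of_le_of_ne (hφ.1 t) (Ne.symm ht)
    have ht' : t⁻¹ ∈ hF.toFinset := by simpa [hφ.2.2.2] using ht
    have a1 : φ t * Ng f t ≤ En hF f := by
      have := Finset.single_le_sum (f := fun s => φ s * Ng f s⁻¹)
        (fun s _ => mul_nonneg (hφ.1 s) (Ng_nonneg _ _)) ht'
      simpa [hφ.2.2.2, En] using this
    have a2 : 1 / φ t ≤ K :=
      Finset.single_le_sum (f := fun s => 1 / φ s)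
        (fun s _ => one_div_nonneg.2 (hφ.1 s)) (by simpa using ht)
    calc Ng f t = 1 / φ t * (φ t * Ng f t) := by field_simp
      _ ≤ K * En hF f := by
        apply mul_le_mul a2 a1 (mul_nonneg (hφ.1 _) (Ng_nonneg _ _)) hK0
  have h2 : ∀ s ∈ S, Ng f s ≤ K' * (K * En hF f) := by
    intro s hs
    have := Ng_word hf _ _ h1 (w s) (hw1 s)
    rw [hw2] at this
    refine this.trans ?_
    gcongr
    exact Finset.single_le_sum (f := fun s => ((w s).length : ℝ) ^ 2)
        (fun s _ => sq_nonneg _) (by simpa using hs)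
  obtain ⟨v, v1, v2, v3⟩ := wl_spec hS y
  have := Ng_word hf _ _ h2 v v1
  rw [v3, v2] at this
  refine this.trans ?_
  have : 0 ≤ (wordLen S y : ℝ) ^ 2 * En hF f := by positivity
  nlinarith

/-- squared l2 norm of the convolution power -/
def an {G : Type*} [Group G] (φ : G → ℝ) (n : ℕ) : ℝ := ∑' x, convPow φ n x ^ 2

lemma an_dissip {G : Type*} [Group G] {φ : G → ℝ} (hF : (Function.support φ).Finite)
    (hφ : IsSymmProb φ) (hφe : 0 < φ 1) (n : ℕ) :
    an φ (n+1) + φ 1 * En hF (convPow φ n) ≤ an φ n :=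
  dissip hF hφ hφe (cp_fs hF n)

lemma En_nonneg {G : Type*} [Group G] {φ : G → ℝ} (hF : (Function.support φ).Finite)
    (hφ : IsSymmProb φ) (f : G → ℝ) : 0 ≤ En hF f :=
    Finset.sum_nonneg (fun s _ => mul_nonneg (hφ.1 s) (Ng_nonneg _ _))

lemma an_anti {G : Type*} [Group G] {φ : G → ℝ} (hF : (Function.support φ).Finite)
    (hφ : IsSymmProb φ) (hφe : 0 < φ 1) : Antitone (an φ) := by
  apply antitone_nat_of_succ_le
  intro n
  have := an_dissip hF hφ hφe n
  have := mul_nonneg hφe.le (En_nonneg hF hφ (convPow φ n))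
  linarith

lemma an_nonneg {G : Type*} [Group G] {φ : G → ℝ} (n : ℕ) : 0 ≤ an φ n :=
  tsum_nonneg (fun _ => sq_nonneg _)

lemma an_le_one {G : Type*} [Group G] {φ : G → ℝ} (hF : (Function.support φ).Finite)
    (hφ : IsSymmProb φ) (hφe : 0 < φ 1) (n : ℕ) : an φ n ≤ 1 := by
  refine (an_anti hF hφ hφe (Nat.zero_le n)).trans (le_of_eq ?_)
  unfold an
  rw [tsum_eq_single (1:G)]
  · simp [convPow]
  · intro y hy; simp [convPow, hy]

lemma ball_fin {G : Type*} [Group G] {S : Set G} {D : ℕ} (hD : PolyGrowth S D) (n : ℕ)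
    (hn : 1 ≤ n) : {g : G | wordLen S g ≤ n}.Finite := by
  obtain ⟨c, C, hc, hC, h⟩ := hD
  have := (h n hn).1
  have h0 : 0 < (vol S n : ℝ) := lt_of_lt_of_le (by positivity) this
  exact Set.finite_of_ncard_pos (by exact_mod_cast h0)

lemma nash {G : Type*} [Group G] {S : Set G} (hS : IsSymmGen S) {D : ℕ} (hD : PolyGrowth S D)
    {φ : G → ℝ} (hF : (Function.support φ).Finite) (hφ : IsSymmProb φ) (hφe : 0 < φ 1)
    (hφgen : Subgroup.closure (Function.support φ) = ⊤) :
    ∃ C₁ C₂ : ℝ, 1 ≤ C₁ ∧ 0 < C₂ ∧ ∀ n r : ℕ, 1 ≤ r →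
      an φ n ≤ C₁ * (r:ℝ) ^ 2 * (an φ n - an φ (n+1)) + C₂ / (r:ℝ) ^ D := by
  obtain ⟨C, hC, hg⟩ := grad_bound hS hF hφ hφgen
  have hD' := hD
  obtain ⟨c, C', hc, hC', hv⟩ := hD'
  have hpp : 0 ≤ C / φ 1 := by positivity
  refine ⟨C / φ 1 + 1, 1 / c, by linarith, by positivity, ?_⟩
  intro n r hr
  have hfin := ball_fin hD r hr
  have hv1 := (hv r hr).1
  have hrpos : (0:ℝ) < r := by exact_mod_cast hr
  have hcard : vol S r = hfin.toFinset.card := by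
    unfold vol
    rw [Set.ncard_eq_toFinset_card _ hfin]
  have hE := En_nonneg hF hφ (convPow φ n)
  have hb : ∀ y ∈ hfin.toFinset, Ng (convPow φ n) y ≤ C * (r:ℝ) ^ 2 * En hF (convPow φ n) := by
    intro y hy
    refine (hg _ (cp_fs hF n) y).trans ?_
    have : (wordLen S y : ℝ) ≤ r := by
      have : wordLen S y ≤ r := by simpa using hy
      exact_mod_cast this
    gcongr
  have := nash_aux (cp_fs hF n) (cp_nonneg hφ n) (cp_sum hF hφ n) hfin.toFinset
    ⟨1, by simp [wl_one]⟩ _ hb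
  rw [← hcard] at this
  change an φ n ≤ _ at this
  refine this.trans ?_
  have hdis := an_dissip hF hφ hφe n
  have hmono := an_anti hF hφ hφe (Nat.le_succ n)
  have h1 : En hF (convPow φ n) ≤ (an φ n - an φ (n+1)) / φ 1 := by
    rw [le_div_iff₀ hφe]; linarith
  have h2 : 1 / (vol S r : ℝ) ≤ 1 / c / (r:ℝ) ^ D := by
    rw [div_div]
    apply one_div_le_one_div_of_le (by positivity) hv1
  have h3 : C * (r:ℝ) ^ 2 * En hF (convPow φ n) ≤ C * (r:ℝ) ^ 2 * ((an φ n - an φ (n+1)) / φ 1) := by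
    gcongr
  have h4 : (C / φ 1 + 1) * (r:ℝ) ^ 2 * (an φ n - an φ (n+1)) =
    C * (r:ℝ) ^ 2 * ((an φ n - an φ (n+1)) / φ 1) + (r:ℝ) ^ 2 * (an φ n - an φ (n+1)) := by
    field_simp
  have h5 : 0 ≤ (r:ℝ) ^ 2 * (an φ n - an φ (n+1)) := by
    apply mul_nonneg (by positivity)
    have : an φ (n+1) ≤ an φ n := hmono
    linarith
  linarith

lemma seq_decay (u : ℕ → ℝ) (g e : ℝ) (hg : 1 ≤ g) (he : 0 ≤ e)
    (h : ∀ n, u n ≤ g * (u n - u (n+1)) + e) (n m : ℕ) :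
    u (n + m) ≤ e + (1 - 1 / g) ^ m * u n := by
  have hg0 : 0 < g := by linarith
  have hg1 : 0 ≤ 1 - 1 / g := by
    have : 1 / g ≤ 1 := by rw [div_le_one hg0]; exact hg
    linarith
  induction m with
  | zero => simp; exact he
  | succ m ih =>
    have h1 := h (n + m)
    have h2 : u (n + m + 1) ≤ (1 - 1 / g) * u (n + m) + e / g := by
      have : g * u (n+m+1) ≤ g * ((1 - 1 / g) * u (n + m) + e / g) := by
        have : g * ((1 - 1 / g) * u (n + m) + e / g) = g * u (n+m) - u (n+m) + e := by
          field_simp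
        linarith
      exact le_of_mul_le_mul_left this hg0
    have h3 := mul_le_mul_of_nonneg_left ih hg1
    have e1 : (1 - 1 / g) * (e + (1 - 1 / g) ^ m * u n) + e / g =
      e + (1 - 1 / g) ^ (m+1) * u n := by ring
    rw [← add_assoc]
    linarith

lemma ondiag {G : Type*} [Group G] {S : Set G} (hS : IsSymmGen S) {D : ℕ} (hD : PolyGrowth S D)
    {φ : G → ℝ} (hF : (Function.support φ).Finite) (hφ : IsSymmProb φ) (hφe : 0 < φ 1)
    (hφgen : Subgroup.closure (Function.support φ) = ⊤) :
    ∃ C : ℝ, 0 < C ∧ ∀ k : ℕ, an φ (4 ^ k) * ((2:ℝ) ^ k) ^ D ≤ C := by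
  obtain ⟨C₁, C₂, hC1, hC2, hn⟩ := nash hS hD hF hφ hφe hφgen
  have hC1' : 0 < C₁ := by linarith
  obtain ⟨p, hp⟩ : ∃ p : ℕ, Real.exp (-(3 * 4 ^ p / C₁)) ≤ 1 / (2 * 2 ^ D) := by
    have : Tendsto (fun p : ℕ => Real.exp (-(3 * (4:ℝ) ^ p / C₁))) atTop (𝓝 0) := by
      apply Real.tendsto_exp_atBot.comp
      apply tendsto_neg_atTop_atBot.comp
      apply Tendsto.atTop_div_const hC1'
      apply Tendsto.const_mul_atTop (by norm_num)
      exact tendsto_pow_atTop_atTop_of_one_lt (by norm_num)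
    have h0 : (0:ℝ) < 1 / (2 * 2 ^ D) := by positivity
    obtain ⟨p, hp⟩ := (this.eventually (ge_mem_nhds h0)).exists
    exact ⟨p, hp⟩
  have step : ∀ k : ℕ, an φ (4 ^ (p + (k+1))) ≤ C₂ / ((2:ℝ) ^ k) ^ D +
      1 / (2 * 2 ^ D) * an φ (4 ^ (p + k)) := by
    intro k
    have hg : 1 ≤ C₁ * ((2:ℝ) ^ k) ^ 2 := by
      have : (1:ℝ) ≤ ((2:ℝ) ^ k) ^ 2 := one_le_pow₀ (one_le_pow₀ (by norm_num))
      nlinarith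
    have := seq_decay (an φ) (C₁ * ((2:ℝ) ^ k) ^ 2) (C₂ / ((2:ℝ) ^ k) ^ D) hg (by positivity)
      (fun n => by have := hn n (2 ^ k) Nat.one_le_two_pow; push_cast at this; exact this)
      (4 ^ (p + k)) (3 * 4 ^ (p + k))
    have e1 : 4 ^ (p + k) + 3 * 4 ^ (p + k) = 4 ^ (p + (k+1)) := by
      rw [show p + (k+1) = (p + k) + 1 by ring, pow_succ 4 (p+k)]; ring
    rw [e1] at this
    refine this.trans ?_
    gcongr
    · exact an_nonneg _
    · refine le_trans ?_ hp
      have h1 : 1 - 1 / (C₁ * ((2:ℝ) ^ k) ^ 2) ≤ Real.exp (-(1 / (C₁ * ((2:ℝ) ^ k) ^ 2))) := by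
        have := Real.add_one_le_exp (-(1 / (C₁ * ((2:ℝ) ^ k) ^ 2)))
        linarith
      have h0 : 0 ≤ 1 - 1 / (C₁ * ((2:ℝ) ^ k) ^ 2) := by
        have : 1 / (C₁ * ((2:ℝ) ^ k) ^ 2) ≤ 1 := by rw [div_le_one (by linarith)]; exact hg
        linarith
      refine (pow_le_pow_left₀ h0 h1 _).trans (le_of_eq ?_)
      rw [← Real.exp_nat_mul]
      congr 1
      push_cast
      have : (4:ℝ) ^ (p + k) = 4 ^ p * ((2:ℝ) ^ k) ^ 2 := by
        rw [pow_add, ← pow_mul, mul_comm k 2, pow_mul]; norm_num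
      rw [this]
      field_simp
  have hb : ∀ k : ℕ, an φ (4 ^ (p + k)) * ((2:ℝ) ^ k) ^ D ≤ 1 + 2 * 2 ^ D * C₂ := by
    intro k
    induction k with
    | zero =>
      have := an_le_one hF hφ hφe (4 ^ (p + 0))
      have h2 : 0 ≤ 2 * 2 ^ D * C₂ := by positivity
      simp at this ⊢
      linarith
    | succ k ih =>
      have h1 := step k
      have h2 : ((2:ℝ) ^ (k+1)) ^ D = 2 ^ D * ((2:ℝ) ^ k) ^ D := by
        rw [pow_succ, mul_pow]; ring
      have hpos : (0:ℝ) < ((2:ℝ) ^ k) ^ D := by positivity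
      rw [h2]
      calc an φ (4 ^ (p + (k + 1))) * (2 ^ D * ((2:ℝ) ^ k) ^ D)
          ≤ (C₂ / ((2:ℝ) ^ k) ^ D + 1 / (2 * 2 ^ D) * an φ (4 ^ (p + k))) *
            (2 ^ D * ((2:ℝ) ^ k) ^ D) := by gcongr
        _ = C₂ * 2 ^ D + 1 / 2 * (an φ (4 ^ (p + k)) * ((2:ℝ) ^ k) ^ D) := by
          field_simp
        _ ≤ _ := by
          have : 0 ≤ 2 ^ D * C₂ := by positivity
          linarith
  refine ⟨(1 + 2 * 2 ^ D * C₂) * ((2:ℝ) ^ p) ^ D, by positivity, ?_⟩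
  intro k
  rcases le_total p k with h | h
  · obtain ⟨i, rfl⟩ := Nat.exists_eq_add_of_le h
    have := hb i
    have e : ((2:ℝ) ^ (p + i)) ^ D = ((2:ℝ) ^ p) ^ D * ((2:ℝ) ^ i) ^ D := by
      rw [pow_add, mul_pow]
    rw [e]
    have hpos : (0:ℝ) < ((2:ℝ) ^ p) ^ D := by positivity
    nlinarith
  · have h1 := an_le_one hF hφ hφe (4 ^ k)
    have h2 : ((2:ℝ) ^ k) ^ D ≤ ((2:ℝ) ^ p) ^ D := by
      gcongr
      norm_num
    have h3 : 0 ≤ 2 * 2 ^ D * C₂ := by positivity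
    have h4 : (0:ℝ) < ((2:ℝ) ^ k) ^ D := by positivity
    nlinarith [mul_le_mul h1 h2 h4.le (by norm_num : (0:ℝ) ≤ 1)]


lemma le_of_sq_le_sq_aux {a b : ℝ} (h : a ^ 2 ≤ b ^ 2) (hb : 0 ≤ b) : a ≤ b :=
  abs_le_of_sq_le_sq' h hb |>.2

/-- weighted squared l2 norm -/
def Iw {G : Type*} [Group G] (S : Set G) (φ : G → ℝ) (α : ℝ) (n : ℕ) : ℝ :=
  ∑' x, Real.exp (2 * α * wordLen S x) * convPow φ n x ^ 2

lemma Iw_nonneg {G : Type*} [Group G] (S : Set G) (φ : G → ℝ) (α : ℝ) (n : ℕ) :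
    0 ≤ Iw S φ α n := tsum_nonneg (fun _ => by positivity)

lemma Iw_step {G : Type*} [Group G] {S : Set G} (hS : IsSymmGen S)
    {φ : G → ℝ} (hF : (Function.support φ).Finite) (hφ : IsSymmProb φ) (hφe : 0 < φ 1) :
    ∃ α₀ C : ℝ, 0 < α₀ ∧ 0 < C ∧ ∀ α, 0 ≤ α → α ≤ α₀ → ∀ n m,
      Iw S φ α (n + m) ≤ Real.exp (C * α ^ 2 * m) * Iw S φ α n := by
  set R : ℝ := 1 + ∑ s ∈ hF.toFinset, (wordLen S s : ℝ) with hR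
  have hRpos : 0 < R := by
    have : 0 ≤ ∑ s ∈ hF.toFinset, (wordLen S s : ℝ) := Finset.sum_nonneg (fun _ _ => by positivity)
    linarith
  have hRle : ∀ s ∈ hF.toFinset, (wordLen S s : ℝ) ≤ R := by
    intro s hs
    have := Finset.single_le_sum (f := fun s => (wordLen S s : ℝ))
      (fun s _ => by positivity) hs
    linarith
  have hinv : ∀ s ∈ hF.toFinset, s⁻¹ ∈ hF.toFinset := by
    intro s hs; simpa [hφ.2.2.2] using hs
  have hθ1 : φ 1 ≤ 1 := by
    rw [← sum_phi hF hφ]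
    exact Finset.single_le_sum (f := φ) (fun s _ => hφ.1 s) (by simpa using hφe.ne')
  refine ⟨φ 1 / (4 * R), 16 * R ^ 2 / φ 1, by positivity, by positivity, ?_⟩
  intro α h0 hα n m
  rw [le_div_iff₀ (by positivity)] at hα
  have key : ∀ n, Iw S φ α (n+1) ≤ (1 + (4 * α * R) ^ 2 / φ 1) * Iw S φ α n := by
    intro n
    refine wcontr hF hφ hφe (cp_fs hF n) (fun x => Real.exp (2 * α * wordLen S x))
      (fun x => (Real.exp_pos _).le) (4 * α * R) (by positivity) (by linarith) ?_
    intro s hs x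
    have h1 : (wordLen S (s⁻¹ * x) : ℝ) ≤ R + wordLen S x := by
      have := wl_mul hS s⁻¹ x
      have h2 := hRle _ (hinv s hs)
      have h3 : (wordLen S (s⁻¹ * x) : ℝ) ≤ wordLen S s⁻¹ + wordLen S x := by exact_mod_cast this
      linarith
    have h2 : (wordLen S x : ℝ) ≤ R + wordLen S (s⁻¹ * x) := by
      have := wl_mul hS s (s⁻¹ * x)
      rw [mul_inv_cancel_left] at this
      have h2 := hRle _ hs
      have h3 : (wordLen S x : ℝ) ≤ wordLen S s + wordLen S (s⁻¹ * x) := by exact_mod_cast this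
      linarith
    set t := 2 * α * ((wordLen S (s⁻¹ * x) : ℝ) - wordLen S x) with ht
    have habs : |t| ≤ 2 * α * R := by
      rw [ht, abs_mul, abs_of_nonneg (by positivity : 0 ≤ 2 * α)]
      gcongr
      rw [abs_le]; constructor <;> linarith
    have e1 : Real.exp (2 * α * wordLen S (s⁻¹ * x)) =
        Real.exp (2 * α * wordLen S x) * Real.exp t := by
      rw [← Real.exp_add]; congr 1; rw [ht]; ring
    rw [e1]
    have e2 : Real.exp (2 * α * wordLen S x) - Real.exp (2 * α * wordLen S x) * Real.exp t
      = - (Real.exp (2 * α * wordLen S x) * (Real.exp t - 1)) := by ring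
    rw [e2, abs_neg, abs_mul, abs_of_pos (Real.exp_pos _), mul_comm]
    gcongr
    have := Real.abs_exp_sub_one_le (x := t) (by nlinarith)
    linarith
  induction m with
  | zero => simp
  | succ m ih =>
    have h1 := key (n + m)
    have h2 : 1 + (4 * α * R) ^ 2 / φ 1 ≤ Real.exp (16 * R ^ 2 / φ 1 * α ^ 2) := by
      have := Real.add_one_le_exp (16 * R ^ 2 / φ 1 * α ^ 2)
      refine le_trans (le_of_eq ?_) this
      ring
    have h3 := Iw_nonneg S φ α (n + m)
    calc Iw S φ α (n + (m+1)) ≤ (1 + (4 * α * R) ^ 2 / φ 1) * Iw S φ α (n + m) := h1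
      _ ≤ Real.exp (16 * R ^ 2 / φ 1 * α ^ 2) *
        (Real.exp (16 * R ^ 2 / φ 1 * α ^ 2 * m) * Iw S φ α n) := by gcongr
      _ = _ := by
        rw [← mul_assoc, ← Real.exp_add]
        congr 2
        push_cast; ring

lemma Iw_half {G : Type*} [Group G] {S : Set G}
    {φ : G → ℝ} (hF : (Function.support φ).Finite) (α : ℝ) (n : ℕ) :
    Iw S φ (α / 2) n ^ 2 ≤ Iw S φ α n * an φ n := by
  unfold Iw an
  apply cs_tsum (fs_of (cp_fs hF n) (fun x h => by rw [h]; ring)) (fun x => by positivity)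
    (fun x => by positivity) (fs_smul (cp_fs hF n) (fun x h => by rw [h]; ring))
  intro x
  apply le_of_eq
  have : Real.exp (2 * α * wordLen S x) = Real.exp (2 * (α / 2) * wordLen S x) ^ 2 := by
    rw [← Real.exp_nat_mul]; congr 1; push_cast; ring
  rw [this]; ring

lemma Iw_bound {G : Type*} [Group G] {S : Set G} (hS : IsSymmGen S) {D : ℕ} (hD : PolyGrowth S D)
    {φ : G → ℝ} (hF : (Function.support φ).Finite) (hφ : IsSymmProb φ) (hφe : 0 < φ 1)
    (hφgen : Subgroup.closure (Function.support φ) = ⊤) :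
    ∃ α K : ℝ, 0 < α ∧ 0 < K ∧ ∀ k n : ℕ, 4 ^ k ≤ n → n ≤ 16 * 4 ^ k →
      Iw S φ (α / 2 ^ k) n * ((2:ℝ) ^ k) ^ D ≤ K := by
  obtain ⟨α, C, hα, hC, hstep⟩ := Iw_step hS hF hφ hφe
  obtain ⟨B, hB, hon⟩ := ondiag hS hD hF hφ hφe hφgen
  have hαk : ∀ k : ℕ, α / 2 ^ k ≤ α := fun k => div_le_self hα.le (one_le_pow₀ (by norm_num))
  set E := Real.exp (C * α ^ 2 * 16) with hE
  have hEpos : 0 < E := Real.exp_pos _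
  have hgrow : ∀ k n m : ℕ, m ≤ 16 * 4 ^ k → Iw S φ (α / 2 ^ k) (n + m) ≤
      E * Iw S φ (α / 2 ^ k) n := by
    intro k n m hm
    refine (hstep (α / 2 ^ k) (by positivity) (hαk k) n m).trans ?_
    have := Iw_nonneg S φ (α / 2 ^ k) n
    gcongr
    rw [hE]
    apply Real.exp_le_exp.2
    have hm' : (m:ℝ) ≤ 16 * 4 ^ k := by exact_mod_cast hm
    have e : C * (α / 2 ^ k) ^ 2 * (16 * 4 ^ k) = C * α ^ 2 * 16 := by
      have : (4:ℝ) ^ k = (2 ^ k) ^ 2 := by rw [← pow_mul, mul_comm k 2, pow_mul]; norm_num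
      rw [this]
      field_simp
    rw [← e]
    gcongr
  set K := Iw S φ α 1 + E ^ 2 * B * 4 ^ D + 1 with hK
  have hI1 := Iw_nonneg S φ α 1
  have hKpos : 0 < K := by positivity
  have main : ∀ k : ℕ, Iw S φ (α / 2 ^ k) (4 ^ k) * ((2:ℝ) ^ k) ^ D ≤ K := by
    intro k
    induction k with
    | zero =>
      simp only [pow_zero, div_one, one_pow, mul_one]
      have : 0 ≤ E ^ 2 * B * 4 ^ D := by positivity
      rw [hK]; linarith
    | succ k ih =>
      set V := ((2:ℝ) ^ k) ^ D with hV
      have hVpos : 0 < V := by positivity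
      have e0 : α / 2 ^ (k+1) = α / 2 ^ k / 2 := by rw [pow_succ]; field_simp
      have h1 : Iw S φ (α / 2 ^ (k+1)) (4 ^ (k+1)) ≤ E * Iw S φ (α / 2 ^ k / 2) (4 ^ k) := by
        have := hgrow (k+1) (4 ^ k) (3 * 4 ^ k) (by rw [pow_succ]; omega)
        have e1 : 4 ^ k + 3 * 4 ^ k = 4 ^ (k+1) := by rw [pow_succ 4 k]; ring
        rw [e1] at this
        rw [← e0]; exact this
      have h2 := Iw_half (S := S) hF (α / 2 ^ k) (4 ^ k)
      have h3 := hon k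
      have e2 : ((2:ℝ) ^ (k+1)) ^ D = 2 ^ D * V := by
        rw [pow_succ, mul_pow]; ring
      have n1 := Iw_nonneg S φ (α / 2 ^ (k+1)) (4 ^ (k+1))
      have n2 := Iw_nonneg S φ (α / 2 ^ k / 2) (4 ^ k)
      have n3 := Iw_nonneg S φ (α / 2 ^ k) (4 ^ k)
      have n4 : 0 ≤ an φ (4 ^ k) := an_nonneg _
      rw [e2]
      apply le_of_sq_le_sq_aux _ hKpos.le
      calc (Iw S φ (α / 2 ^ (k+1)) (4 ^ (k+1)) * (2 ^ D * V)) ^ 2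
          ≤ (E * Iw S φ (α / 2 ^ k / 2) (4 ^ k) * (2 ^ D * V)) ^ 2 := by gcongr
        _ = E ^ 2 * 4 ^ D * V ^ 2 * Iw S φ (α / 2 ^ k / 2) (4 ^ k) ^ 2 := by
          have : (4:ℝ) ^ D = (2 ^ D) ^ 2 := by rw [← pow_mul, mul_comm D 2, pow_mul]; norm_num
          rw [this]; ring
        _ ≤ E ^ 2 * 4 ^ D * V ^ 2 * (Iw S φ (α / 2 ^ k) (4 ^ k) * an φ (4 ^ k)) := by gcongr
        _ = E ^ 2 * 4 ^ D * ((Iw S φ (α / 2 ^ k) (4 ^ k) * V) * (an φ (4 ^ k) * V)) := by ring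
        _ ≤ E ^ 2 * 4 ^ D * (K * B) := by gcongr
        _ = (E ^ 2 * B * 4 ^ D) * K := by ring
        _ ≤ K * K := by gcongr; rw [hK]; linarith
        _ = K ^ 2 := by ring
  refine ⟨α, E * K, hα, by positivity, ?_⟩
  intro k n h1 h2
  obtain ⟨m, rfl⟩ := Nat.exists_eq_add_of_le h1
  have := hgrow k (4 ^ k) m (by omega)
  calc Iw S φ (α / 2 ^ k) (4 ^ k + m) * ((2:ℝ) ^ k) ^ D
      ≤ E * Iw S φ (α / 2 ^ k) (4 ^ k) * ((2:ℝ) ^ k) ^ D := by gcongr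
    _ = E * (Iw S φ (α / 2 ^ k) (4 ^ k) * ((2:ℝ) ^ k) ^ D) := by ring
    _ ≤ E * K := by gcongr; exact main k

lemma cp_weight {G : Type*} [Group G] {S : Set G} (hS : IsSymmGen S)
    {φ : G → ℝ} (hF : (Function.support φ).Finite) (hφ : IsSymmProb φ) (α : ℝ) (hα : 0 ≤ α)
    (m n : ℕ) (x : G) :
    (Real.exp (α * wordLen S x) * convPow φ (m + n) x) ^ 2 ≤ Iw S φ α m * Iw S φ α n := by
  rw [cp_add hF, ← tsum_mul_left]
  have e : Iw S φ α n = ∑' y, Real.exp (2 * α * wordLen S (y⁻¹ * x)) *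
      convPow φ n (y⁻¹ * x) ^ 2 := by
    unfold Iw
    exact (((Equiv.inv G).trans (Equiv.mulRight x)).tsum_eq
      (fun z => Real.exp (2 * α * wordLen S z) * convPow φ n z ^ 2)).symm
  have hsum : ∑' y, Real.exp (α * wordLen S x) * (convPow φ m y * convPow φ n (y⁻¹ * x)) ≤
      ∑' y, (Real.exp (α * wordLen S y) * convPow φ m y) *
        (Real.exp (α * wordLen S (y⁻¹ * x)) * convPow φ n (y⁻¹ * x)) := by
    apply Summable.tsum_le_tsum
    · intro y
      have h1 := cp_nonneg hφ m y
      have h2 := cp_nonneg hφ n (y⁻¹ * x)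
      have h3 : Real.exp (α * wordLen S x) ≤ Real.exp (α * wordLen S y) *
          Real.exp (α * wordLen S (y⁻¹ * x)) := by
        rw [← Real.exp_add]
        apply Real.exp_le_exp.2
        have := wl_mul hS y (y⁻¹ * x)
        rw [mul_inv_cancel_left] at this
        have h4 : (wordLen S x : ℝ) ≤ wordLen S y + wordLen S (y⁻¹ * x) := by exact_mod_cast this
        nlinarith
      calc _ ≤ (Real.exp (α * wordLen S y) *
          Real.exp (α * wordLen S (y⁻¹ * x))) * (convPow φ m y * convPow φ n (y⁻¹ * x)) := by gcongr
        _ = _ := by ring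
    · exact fs_smul (cp_fs hF m) (fun y h => by rw [h]; ring)
    · exact fs_smul (cp_fs hF m) (fun y h => by rw [h]; ring)
  have h0 : 0 ≤ ∑' y, Real.exp (α * wordLen S x) * (convPow φ m y * convPow φ n (y⁻¹ * x)) :=
    tsum_nonneg (fun y => mul_nonneg (Real.exp_pos _).le
      (mul_nonneg (cp_nonneg hφ _ _) (cp_nonneg hφ _ _)))
  refine (pow_le_pow_left₀ h0 hsum 2).trans ?_
  rw [e]
  unfold Iw
  refine cs_tsum (A := fun y => Real.exp (2 * α * wordLen S y) * convPow φ m y ^ 2)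
    (B := fun y => Real.exp (2 * α * wordLen S (y⁻¹ * x)) * convPow φ n (y⁻¹ * x) ^ 2)
    (fs_of (cp_fs hF m) (fun x h => by rw [h]; ring)) (fun x => by positivity)
    (fun x => by positivity) ?_ ?_
  · have h1 : Summable (fun z => Real.exp (2 * α * wordLen S z) * convPow φ n z ^ 2) :=
      fs_smul (cp_fs hF n) (fun x h => by rw [h]; ring)
    have h2 := ((Equiv.inv G).trans (Equiv.mulRight x)).summable_iff.2 h1
    exact h2
  · intro y
    apply le_of_eq
    have : ∀ z : G, Real.exp (2 * α * wordLen S z) = Real.exp (α * wordLen S z) ^ 2 := by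
      intro z
      rw [← Real.exp_nat_mul]; congr 1; push_cast; ring
    rw [this, this]; ring

lemma hku {G : Type*} [Group G] {S : Set G} (hS : IsSymmGen S) {D : ℕ} (hD : PolyGrowth S D)
    {φ : G → ℝ} (hF : (Function.support φ).Finite) (hφ : IsSymmProb φ) (hφe : 0 < φ 1)
    (hφgen : Subgroup.closure (Function.support φ) = ⊤) :
    ∃ α K : ℝ, 0 < α ∧ 0 < K ∧ ∀ k n : ℕ, ∀ x, 4 ^ k ≤ n → n < 4 ^ (k+1) →
      convPow φ n x * ((2:ℝ) ^ k) ^ D ≤ K * Real.exp (-(α * (wordLen S x / 2 ^ k))) := by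
  obtain ⟨α, K, hα, hK, h⟩ := Iw_bound hS hD hF hφ hφe hφgen
  refine ⟨α, K * 2 ^ D + (K + 1), hα, by positivity, ?_⟩
  intro k n x h1 h2
  have hcp := cp_nonneg hφ n x
  rcases k with _ | k
  · have hb := h 0 n h1 (by omega)
    simp only [pow_zero, div_one, one_pow, mul_one] at hb ⊢
    have h3 := cp_weight hS hF hφ α hα.le 0 n x
    have h4 : Iw S φ α 0 = 1 := by
      unfold Iw
      rw [tsum_eq_single (1:G)]
      · simp [convPow, wl_one]
      · intro y hy; simp [convPow, hy]
    rw [h4, zero_add, one_mul] at h3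
    have h5 : Real.exp (α * wordLen S x) * convPow φ n x ≤ K + 1 := by
      apply le_of_sq_le_sq_aux _ (by positivity)
      nlinarith
    have h6 : convPow φ n x ≤ (K + 1) * Real.exp (-(α * wordLen S x)) := by
      rw [Real.exp_neg, ← div_eq_mul_inv, le_div_iff₀ (Real.exp_pos _)]; linarith
    refine h6.trans ?_
    have : 0 ≤ K * 2 ^ D := by positivity
    exact mul_le_mul_of_nonneg_right (by linarith) (Real.exp_pos _).le
  · set V := ((2:ℝ) ^ k) ^ D with hV
    have hVpos : 0 < V := by positivity
    have e2 : ((2:ℝ) ^ (k+1)) ^ D = 2 ^ D * V := by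
      rw [pow_succ, mul_pow]; ring
    rw [e2]
    have p4 : 4 ^ (k+1) = 4 * 4 ^ k := by ring
    have p5 : 4 ^ (k+1+1) = 16 * 4 ^ k := by ring
    obtain ⟨m, rfl⟩ : ∃ m, n = 4 ^ k + m := Nat.exists_eq_add_of_le (by omega)
    have b1 := h k (4 ^ k) le_rfl (by omega)
    have b2 := h k m (by omega) (by omega)
    have h3 := cp_weight hS hF hφ (α / 2 ^ k) (by positivity) (4 ^ k) m x
    have n1 := Iw_nonneg S φ (α / 2 ^ k) (4 ^ k)
    have n2 := Iw_nonneg S φ (α / 2 ^ k) m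
    have h5 : Real.exp (α / 2 ^ k * wordLen S x) * convPow φ (4 ^ k + m) x * V ≤ K := by
      apply le_of_sq_le_sq_aux _ (by positivity)
      calc _ = (Real.exp (α / 2 ^ k * wordLen S x) * convPow φ (4 ^ k + m) x) ^ 2 * V ^ 2 := by ring
        _ ≤ (Iw S φ (α / 2 ^ k) (4 ^ k) * Iw S φ (α / 2 ^ k) m) * V ^ 2 := by gcongr
        _ = (Iw S φ (α / 2 ^ k) (4 ^ k) * V) * (Iw S φ (α / 2 ^ k) m * V) := by ring
        _ ≤ K * K := by gcongr
        _ = K ^ 2 := by ring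
    have h6 : convPow φ (4 ^ k + m) x * V ≤ K * Real.exp (-(α / 2 ^ k * wordLen S x)) := by
      rw [Real.exp_neg, ← div_eq_mul_inv, le_div_iff₀ (Real.exp_pos _)]; linarith
    have h7 : Real.exp (-(α / 2 ^ k * wordLen S x)) ≤
        Real.exp (-(α * (wordLen S x / 2 ^ (k+1)))) := by
      apply Real.exp_le_exp.2
      have e : α / 2 ^ k * wordLen S x = 2 * (α * (wordLen S x / 2 ^ (k+1))) := by
        rw [pow_succ]; field_simp
      rw [e]
      have : 0 ≤ α * (wordLen S x / 2 ^ (k+1)) := by positivity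
      linarith
    calc convPow φ (4 ^ k + m) x * (2 ^ D * V) = 2 ^ D * (convPow φ (4 ^ k + m) x * V) := by ring
      _ ≤ 2 ^ D * (K * Real.exp (-(α * (wordLen S x / 2 ^ (k+1))))) := by
        exact mul_le_mul_of_nonneg_left (h6.trans (mul_le_mul_of_nonneg_left h7 hK.le)) (by positivity)
      _ = (K * 2 ^ D) * Real.exp (-(α * (wordLen S x / 2 ^ (k+1)))) := by ring
      _ ≤ _ := mul_le_mul_of_nonneg_right (by linarith) (Real.exp_pos _).le


lemma Zb {G : Type*} [Group G] {S : Set G} {D : ℕ} (hD : PolyGrowth S D) (α : ℝ) (hα : 0 < α) :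
    ∃ C : ℝ, 0 < C ∧ ∀ k : ℕ, Summable (fun x : G => Real.exp (-(α / 2 ^ k * wordLen S x))) ∧
      ∑' x : G, Real.exp (-(α / 2 ^ k * wordLen S x)) ≤ C * ((2:ℝ) ^ k) ^ D := by
  have hfin := ball_fin hD
  obtain ⟨c, C, hc, hC, h⟩ := hD
  have hs : Summable (fun j : ℕ => ((j:ℝ) + 1) ^ D * Real.exp (-(α * j))) := by
    have h1 := (summable_nat_add_iff 1).2 (Real.summable_pow_mul_exp_neg_nat_mul D hα)
    have h2 := h1.mul_left (Real.exp α)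
    refine h2.congr ?_
    intro j
    rw [mul_left_comm, ← Real.exp_add]
    push_cast
    congr 2
    ring
  set T := ∑' j : ℕ, ((j:ℝ) + 1) ^ D * Real.exp (-(α * j)) with hT
  have hT0 : 0 ≤ T := tsum_nonneg (fun j => by positivity)
  have key : ∀ k : ℕ, ∀ F : Finset G, ∑ x ∈ F, Real.exp (-(α / 2 ^ k * wordLen S x)) ≤
      (C * (T + 1)) * ((2:ℝ) ^ k) ^ D := by
    intro k F
    rw [← Finset.sum_fiberwise_of_maps_to (t := F.image (fun x => wordLen S x / 2 ^ k))
      (g := fun x => wordLen S x / 2 ^ k) (fun x hx => Finset.mem_image_of_mem _ hx)]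
    have hfib : ∀ j : ℕ, ∑ x ∈ F with wordLen S x / 2 ^ k = j,
        Real.exp (-(α / 2 ^ k * wordLen S x)) ≤
        (C * ((2:ℝ) ^ k) ^ D) * (((j:ℝ) + 1) ^ D * Real.exp (-(α * j))) := by
      intro j
      have h1 : ∀ x ∈ F.filter (fun x => wordLen S x / 2 ^ k = j),
          Real.exp (-(α / 2 ^ k * wordLen S x)) ≤ Real.exp (-(α * j)) := by
        intro x hx
        apply Real.exp_le_exp.2
        have h2 : j * 2 ^ k ≤ wordLen S x := by
          rw [← (Finset.mem_filter.1 hx).2]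
          exact Nat.div_mul_le_self _ _
        have h3 : (j:ℝ) * 2 ^ k ≤ wordLen S x := by exact_mod_cast h2
        rw [neg_le_neg_iff, div_mul_eq_mul_div, le_div_iff₀ (by positivity), mul_assoc]
        gcongr
      have h2 := Finset.sum_le_card_nsmul _ _ _ h1
      refine h2.trans ?_
      rw [nsmul_eq_mul]
      have h4 : 1 ≤ (j + 1) * 2 ^ k := Nat.mul_pos (by omega) (by positivity)
      have h5 : (F.filter (fun x => wordLen S x / 2 ^ k = j)).card ≤ vol S ((j + 1) * 2 ^ k) := by
        unfold vol
        rw [← Set.ncard_coe_finset]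
        apply Set.ncard_le_ncard _ (hfin _ h4)
        intro x hx
        have := (Finset.mem_filter.1 (Finset.mem_coe.1 hx)).2
        have h6 := Nat.lt_div_mul_add (a := wordLen S x) (b := 2 ^ k) (by positivity)
        rw [this] at h6
        show wordLen S x ≤ _
        rw [add_mul, one_mul]
        exact h6.le
      have h6 := (h _ h4).2
      have h7 : ((F.filter (fun x => wordLen S x / 2 ^ k = j)).card : ℝ) ≤
          C * (((j:ℝ) + 1) * 2 ^ k) ^ D := by
        refine le_trans (by exact_mod_cast h5) (h6.trans (le_of_eq ?_))
        push_cast; ring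
      calc _ ≤ C * (((j:ℝ) + 1) * 2 ^ k) ^ D * Real.exp (-(α * j)) :=
            mul_le_mul_of_nonneg_right h7 (Real.exp_pos _).le
        _ = _ := by rw [mul_pow]; ring
    refine (Finset.sum_le_sum (fun j _ => hfib j)).trans ?_
    rw [← Finset.mul_sum]
    have h8 := hs.sum_le_tsum (F.image (fun x => wordLen S x / 2 ^ k)) (fun j _ => by positivity)
    calc _ ≤ (C * ((2:ℝ) ^ k) ^ D) * T := mul_le_mul_of_nonneg_left h8 (by positivity)
      _ ≤ (C * ((2:ℝ) ^ k) ^ D) * (T + 1) := mul_le_mul_of_nonneg_left (by linarith) (by positivity)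
      _ = _ := by ring
  refine ⟨C * (T + 1), by positivity, fun k => ⟨?_, ?_⟩⟩
  · exact summable_of_sum_le (fun x => (Real.exp_pos _).le) (key k)
  · exact Real.tsum_le_of_sum_le (fun x => (Real.exp_pos _).le) (key k)

lemma an_lower {G : Type*} [Group G] {S : Set G} (hS : IsSymmGen S) {D : ℕ} (hD : PolyGrowth S D)
    {φ : G → ℝ} (hF : (Function.support φ).Finite) (hφ : IsSymmProb φ) (hφe : 0 < φ 1)
    (hφgen : Subgroup.closure (Function.support φ) = ⊤) :
    ∃ c : ℝ, 0 < c ∧ ∀ k : ℕ, c ≤ an φ (4 ^ k) * ((2:ℝ) ^ k) ^ D := by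
  obtain ⟨α, K, hα, hK, h⟩ := Iw_bound hS hD hF hφ hφe hφgen
  obtain ⟨C, hC, hZ⟩ := Zb hD α hα
  refine ⟨1 / (K * C ^ 2), by positivity, ?_⟩
  intro k
  obtain ⟨z1, z2⟩ := hZ k
  set Z := ∑' x : G, Real.exp (-(α / 2 ^ k * wordLen S x)) with hZdef
  have hZ0 : 0 ≤ Z := tsum_nonneg (fun x => (Real.exp_pos _).le)
  set V := ((2:ℝ) ^ k) ^ D with hV
  have hVpos : 0 < V := by positivity
  have h1 : (∑' x, convPow φ (4 ^ k) x) ^ 2 ≤ Iw S φ (α / 2 ^ k / 2) (4 ^ k) * Z := by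
    unfold Iw
    apply cs_tsum (fs_of (cp_fs hF (4 ^ k)) (fun x h => by rw [h]; ring)) (fun x => by positivity)
      (fun x => (Real.exp_pos _).le) z1
    intro x
    apply le_of_eq
    rw [mul_right_comm, ← Real.exp_add]
    have : 2 * (α / 2 ^ k / 2) * (wordLen S x : ℝ) + -(α / 2 ^ k * wordLen S x) = 0 := by ring
    rw [this, Real.exp_zero, one_mul]
  rw [cp_sum hF hφ, one_pow] at h1
  have h2 := Iw_half (S := S) hF (α / 2 ^ k) (4 ^ k)
  have h3 := h k (4 ^ k) le_rfl (by omega)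
  have n2 := Iw_nonneg S φ (α / 2 ^ k / 2) (4 ^ k)
  have n3 := Iw_nonneg S φ (α / 2 ^ k) (4 ^ k)
  have n4 : 0 ≤ an φ (4 ^ k) := an_nonneg _
  rw [div_le_iff₀ (by positivity)]
  calc (1:ℝ) = 1 ^ 2 := by ring
    _ ≤ (Iw S φ (α / 2 ^ k / 2) (4 ^ k) * Z) ^ 2 := pow_le_pow_left₀ zero_le_one h1 2
    _ = Iw S φ (α / 2 ^ k / 2) (4 ^ k) ^ 2 * Z ^ 2 := by ring
    _ ≤ (Iw S φ (α / 2 ^ k) (4 ^ k) * an φ (4 ^ k)) * (C * V) ^ 2 := by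
      apply mul_le_mul h2 (pow_le_pow_left₀ hZ0 z2 2) (by positivity) (by positivity)
    _ = (Iw S φ (α / 2 ^ k) (4 ^ k) * V) * (an φ (4 ^ k) * V * C ^ 2) := by ring
    _ ≤ K * (an φ (4 ^ k) * V * C ^ 2) := mul_le_mul_of_nonneg_right h3 (by positivity)
    _ = _ := by ring

lemma cp_two {G : Type*} [Group G]
    {φ : G → ℝ} (hF : (Function.support φ).Finite) (hφ : IsSymmProb φ) (q : ℕ) :
    convPow φ (2 * q) 1 = an φ q := by
  rw [two_mul, cp_add hF]
  unfold an
  apply tsum_congr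
  intro y
  rw [mul_one, cp_symm hF hφ]; ring

lemma cp_diff {G : Type*} [Group G]
    {φ : G → ℝ} (hF : (Function.support φ).Finite) (hφ : IsSymmProb φ) (n m : ℕ) (x : G) :
    (convPow φ (n + m) x - convPow φ (n + m) 1) ^ 2 ≤ Ng (convPow φ n) x * an φ m := by
  have h1 : convPow φ (n + m) x = ∑' z, convPow φ n (x * z) * convPow φ m z := by
    rw [cp_add hF, ← tsum_translate _ x]
    apply tsum_congr
    intro z
    rw [← cp_symm hF hφ m z]
    congr 2
    group
  have h2 : convPow φ (n + m) 1 = ∑' z, convPow φ n z * convPow φ m z := by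
    rw [cp_add hF]
    apply tsum_congr
    intro z
    rw [mul_one, cp_symm hF hφ]
  rw [h1, h2, ← Summable.tsum_sub]
  · unfold Ng an
    refine cs_tsum (A := fun z => (convPow φ n (x * z) - convPow φ n z) ^ 2)
      (B := fun z => convPow φ m z ^ 2) ?_ (fun x => sq_nonneg _) (fun x => sq_nonneg _)
      (fs_smul (cp_fs hF m) (fun x h => by rw [h]; ring)) ?_
    · refine fs_of (fs_add (fs_trans (cp_fs hF n) x) (cp_fs hF n)) ?_
      intro z hz
      have h1 := abs_nonneg (convPow φ n (x * z))
      have h2 := abs_nonneg (convPow φ n z)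
      have h3 : convPow φ n (x * z) = 0 := abs_eq_zero.1 (by linarith)
      have h4 : convPow φ n z = 0 := abs_eq_zero.1 (by linarith)
      rw [h3, h4]; ring
    · intro z; apply le_of_eq; ring
  · exact fs_smul (cp_fs hF m) (fun x h => by rw [h]; ring)
  · exact fs_smul (cp_fs hF m) (fun x h => by rw [h]; ring)

lemma small_En {G : Type*} [Group G]
    {φ : G → ℝ} (hF : (Function.support φ).Finite) (hφ : IsSymmProb φ) (hφe : 0 < φ 1)
    (N : ℕ) (hN : 1 ≤ N) : ∃ n, N ≤ n ∧ n < 2 * N ∧ φ 1 * N * En hF (convPow φ n) ≤ an φ N := by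
  by_contra hcon
  push Not at hcon
  have h1 : ∀ j, j ≤ N → an φ (N + j) + j * (an φ N / N) ≤ an φ N := by
    intro j
    induction j with
    | zero => intro _; simp
    | succ j ih =>
      intro hj
      have h2 := ih (by omega)
      have h3 := hcon (N + j) (by omega) (by omega)
      have h4 := an_dissip hF hφ hφe (N + j)
      have h5 : an φ N / N ≤ φ 1 * En hF (convPow φ (N + j)) := by
        rw [div_le_iff₀ (by exact_mod_cast hN)]; linarith
      rw [← add_assoc]
      push_cast
      linarith
  obtain ⟨hN0⟩ : Nonempty ((N:ℝ) ≠ 0) := ⟨by exact_mod_cast (by omega : N ≠ 0)⟩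
  have h2 := h1 (N - 1) (by omega)
  have h3 := hcon (N + (N - 1)) (by omega) (by omega)
  have h4 := an_dissip hF hφ hφe (N + (N - 1))
  have h5 : an φ N / N < φ 1 * En hF (convPow φ (N + (N - 1))) := by
    rw [div_lt_iff₀ (by exact_mod_cast hN)]; linarith
  have h6 : 0 ≤ an φ (N + (N - 1) + 1) := an_nonneg _
  have h7 : ((N - 1 : ℕ) : ℝ) = N - 1 := by push_cast [Nat.cast_sub hN]; ring
  rw [h7] at h2
  have h8 : ((N:ℝ) - 1) * (an φ N / N) = an φ N - an φ N / N := by field_simp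
  linarith

lemma hkl {G : Type*} [Group G] {S : Set G} (hS : IsSymmGen S) {D : ℕ} (hD : PolyGrowth S D)
    {φ : G → ℝ} (hF : (Function.support φ).Finite) (hφ : IsSymmProb φ) (hφe : 0 < φ 1)
    (hφgen : Subgroup.closure (Function.support φ) = ⊤) :
    ∃ ε c : ℝ, 0 < ε ∧ 0 < c ∧ ∀ k q : ℕ, ∀ x, 2 * 4 ^ k ≤ q → q ≤ 4 * 4 ^ k →
      (wordLen S x : ℝ) ≤ ε * 2 ^ k → c ≤ convPow φ (2 * q) x * ((2:ℝ) ^ k) ^ D := by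
  obtain ⟨c, hc, hlow⟩ := an_lower hS hD hF hφ hφe hφgen
  obtain ⟨B, hB, hup⟩ := ondiag hS hD hF hφ hφe hφgen
  obtain ⟨C, hC, hgr⟩ := grad_bound hS hF hφ hφgen
  set c1 := c / 2 ^ D with hc1
  have hc1p : 0 < c1 := by positivity
  set ε := c1 / 2 * Real.sqrt (φ 1 / (C * B ^ 2)) with hε
  have hεp : 0 < ε := by positivity
  have hε2 : C * ε ^ 2 * B ^ 2 / φ 1 = (c1 / 2) ^ 2 := by
    rw [hε, mul_pow, Real.sq_sqrt (by positivity)]; field_simp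
  refine ⟨ε, c1 / 2, hεp, by positivity, ?_⟩
  intro k q x h1 h2 hx
  set V := ((2:ℝ) ^ k) ^ D with hV
  have hVpos : 0 < V := by positivity
  have hdiag : c1 ≤ convPow φ (2 * q) 1 * V := by
    rw [cp_two hF hφ]
    have h3 := an_anti hF hφ hφe (show q ≤ 4 ^ (k+1) by rw [pow_succ]; omega)
    have h4 := hlow (k+1)
    have e2 : ((2:ℝ) ^ (k+1)) ^ D = 2 ^ D * V := by
      rw [pow_succ, mul_pow]; ring
    rw [e2] at h4
    rw [hc1, div_le_iff₀ (by positivity)]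
    calc c ≤ an φ (4 ^ (k+1)) * (2 ^ D * V) := h4
      _ ≤ an φ q * (2 ^ D * V) := mul_le_mul_of_nonneg_right h3 (by positivity)
      _ = _ := by ring
  obtain ⟨n, hn1, hn2, hn3⟩ := small_En hF hφ hφe (4 ^ k) (Nat.one_le_pow _ _ (by norm_num))
  obtain ⟨m, hm⟩ := Nat.exists_eq_add_of_le (show n ≤ 2 * q by omega)
  have hdiff := cp_diff hF hφ n m x
  rw [← hm] at hdiff
  have h3 := hgr _ (cp_fs hF n) x
  have h4 := hup k
  have h5 := an_anti hF hφ hφe (show 4 ^ k ≤ m by omega)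
  have n4 : 0 ≤ an φ (4 ^ k) := an_nonneg _
  have n5 : 0 ≤ an φ m := an_nonneg _
  have n6 := En_nonneg hF hφ (convPow φ n)
  have p4 : ((4 ^ k : ℕ) : ℝ) = (2 ^ k) ^ 2 := by
    push_cast; rw [← pow_mul, mul_comm k 2, pow_mul]; norm_num
  rw [p4] at hn3
  have h6 : ((convPow φ (2 * q) x - convPow φ (2 * q) 1) * V) ^ 2 ≤ (c1 / 2) ^ 2 := by
    calc _ = (convPow φ (2 * q) x - convPow φ (2 * q) 1) ^ 2 * V ^ 2 := by ring
      _ ≤ (C * (ε * 2 ^ k) ^ 2 * En hF (convPow φ n) * an φ (4 ^ k)) * V ^ 2 := by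
        apply mul_le_mul_of_nonneg_right _ (by positivity)
        refine hdiff.trans (mul_le_mul (h3.trans ?_) h5 n5 (by positivity))
        gcongr
      _ = C * ε ^ 2 / φ 1 * (φ 1 * (2 ^ k) ^ 2 * En hF (convPow φ n)) * an φ (4 ^ k) * V ^ 2 := by
        field_simp
      _ ≤ C * ε ^ 2 / φ 1 * an φ (4 ^ k) * an φ (4 ^ k) * V ^ 2 := by gcongr
      _ = C * ε ^ 2 / φ 1 * (an φ (4 ^ k) * V) ^ 2 := by ring
      _ ≤ C * ε ^ 2 / φ 1 * B ^ 2 := by gcongr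
      _ = _ := by rw [← hε2]; ring
  have h7 := (abs_le_of_sq_le_sq' h6 (by positivity)).1
  linarith


lemma bern_pos {ν : Measure ℝ} (h : ν (Set.Iic 0) = 0) : ∀ᵐ t ∂ν, (0:ℝ) < t := by
  rw [ae_iff]
  have : {t : ℝ | ¬ 0 < t} = Set.Iic 0 := by ext t; simp
  rw [this]; exact h

lemma bern_int {ν : Measure ℝ} (h : ν (Set.Iic 0) = 0)
    (hi : Integrable (fun t => t / (1 + t)) ν) (s : ℝ) (hs : 0 < s) :
    Integrable (fun t => 1 - Real.exp (-(s * t))) ν := by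
  refine (hi.const_mul (1 + s)).mono' (by fun_prop) ?_
  filter_upwards [bern_pos h] with t ht
  have h0 : 0 ≤ 1 - Real.exp (-(s * t)) := by
    have : Real.exp (-(s * t)) ≤ 1 := Real.exp_le_one_iff.2 (by nlinarith)
    linarith
  rw [Real.norm_of_nonneg h0, ← mul_div_assoc, le_div_iff₀ (by positivity)]
  have h1 : 1 - Real.exp (-(s * t)) ≤ s * t := by
    have := Real.add_one_le_exp (-(s * t)); linarith
  have h2 : 1 - Real.exp (-(s * t)) ≤ 1 := by
    have := Real.exp_pos (-(s * t)); linarith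
  nlinarith

lemma bern_concave {ψ : ℝ → ℝ} {b : ℝ} {ν : Measure ℝ} (h : IsBernsteinRep ψ 0 b ν) :
    ConcaveOn ℝ (Set.Ioi 0) ψ := by
  obtain ⟨-, hb, h0, hi, hψ⟩ := h
  refine ⟨convex_Ioi 0, ?_⟩
  intro x hx y hy p q hp hq hpq
  have hx' : 0 < x := hx
  have hy' : 0 < y := hy
  have hz : 0 < p • x + q • y := (convex_Ioi (0:ℝ)) hx hy hp hq hpq
  rw [hψ x hx', hψ y hy', hψ _ hz]
  have i1 := bern_int h0 hi x hx'
  have i2 := bern_int h0 hi y hy'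
  have i3 := bern_int h0 hi _ hz
  simp only [smul_eq_mul] at *
  have key : p * ∫ t, (1 - Real.exp (-(x * t))) ∂ν + q * ∫ t, (1 - Real.exp (-(y * t))) ∂ν ≤
      ∫ t, (1 - Real.exp (-((p * x + q * y) * t))) ∂ν := by
    rw [← integral_const_mul, ← integral_const_mul, ← integral_add (i1.const_mul p) (i2.const_mul q)]
    apply integral_mono ((i1.const_mul p).add (i2.const_mul q)) i3
    intro t
    have := convexOn_exp.2 (Set.mem_univ (-(x * t))) (Set.mem_univ (-(y * t))) hp hq hpq
    simp only [smul_eq_mul] at this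
    have e : p * -(x * t) + q * -(y * t) = -((p * x + q * y) * t) := by ring
    rw [e] at this
    show p * (1 - Real.exp (-(x * t))) + q * (1 - Real.exp (-(y * t))) ≤ _
    have e2 : p * 1 + q * 1 = 1 := by linarith
    nlinarith
  linarith

lemma bern_summ {ψ : ℝ → ℝ} {b : ℝ} {ν : Measure ℝ} (h : IsBernsteinRep ψ 0 b ν) :
    (∀ n, 0 ≤ cPsi b ν n) ∧ Summable (cPsi b ν) := by
  obtain ⟨-, hb, h0, hi, hψ⟩ := h
  have hpos := bern_pos h0
  have i1 := bern_int h0 hi 1 one_pos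
  simp only [one_mul] at i1
  have hsum : ∀ N : ℕ, ∀ t : ℝ, 0 < t → ∑ n ∈ Finset.range N,
      (1 / ((n+1).factorial : ℝ)) * (t ^ (n+1) * Real.exp (-t)) ≤ 1 - Real.exp (-t) := by
    intro N t ht
    have h1 := Real.sum_le_exp_of_nonneg ht.le (N+1)
    rw [Finset.sum_range_succ'] at h1
    simp only [pow_zero, Nat.factorial_zero, Nat.cast_one, div_one] at h1
    have h2 : (∑ n ∈ Finset.range N, t ^ (n+1) / ((n+1).factorial : ℝ)) * Real.exp (-t) ≤
        (Real.exp t - 1) * Real.exp (-t) := by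
      apply mul_le_mul_of_nonneg_right _ (Real.exp_pos _).le
      linarith
    rw [sub_mul, ← Real.exp_add, add_neg_cancel, Real.exp_zero, one_mul, Finset.sum_mul] at h2
    refine le_trans (le_of_eq ?_) h2
    apply Finset.sum_congr rfl
    intro n _
    ring
  have iterm : ∀ n : ℕ, Integrable (fun t => (1 / ((n+1).factorial : ℝ)) *
      (t ^ (n+1) * Real.exp (-t))) ν := by
    intro n
    refine i1.mono' (by fun_prop) ?_
    filter_upwards [hpos] with t ht
    rw [Real.norm_of_nonneg (by positivity)]
    refine le_trans ?_ (hsum (n+1) t ht)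
    exact Finset.single_le_sum (f := fun n => (1 / ((n+1).factorial : ℝ)) *
      (t ^ (n+1) * Real.exp (-t))) (fun i _ => by positivity) (Finset.self_mem_range_succ n)
  have hc : ∀ n, cPsi b ν (n+1) = (if n = 0 then b else 0) +
      ∫ t, (1 / ((n+1).factorial : ℝ)) * (t ^ (n+1) * Real.exp (-t)) ∂ν := by
    intro n
    unfold cPsi
    rw [integral_const_mul]
    simp
  have hnn : ∀ n, 0 ≤ cPsi b ν n := by
    intro n
    rcases n with _ | n
    · simp [cPsi]
    · rw [hc]
      apply add_nonneg
      · split_ifs <;> simp [hb]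
      · apply integral_nonneg_of_ae
        filter_upwards [hpos] with t ht
        simp only [Pi.zero_apply]
        positivity
  refine ⟨hnn, ?_⟩
  apply (summable_nat_add_iff 1).1
  refine summable_of_sum_range_le (c := b + ∫ t, (1 - Real.exp (-t)) ∂ν) (fun n => hnn _) ?_
  intro N
  simp only [hc]
  rw [Finset.sum_add_distrib, ← integral_finsetSum _ (fun i _ => iterm i)]
  apply add_le_add
  · rw [Finset.sum_ite_eq']
    split_ifs <;> simp [hb]
  · apply integral_mono_ae (integrable_finsetSum _ (fun i _ => iterm i)) i1
    filter_upwards [hpos] with t ht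
    exact hsum N t ht

lemma sv_pairs {l : ℝ → ℝ} (hlsv : SlowlyVarying l) (hlpos : ∀ x, 1 ≤ x → 0 < l x)
    {a : ℝ} (ha : 0 < a) {g : ℝ → ℝ} (hg : ∀ x y, 0 < x → x ≤ y → g x ≤ g y)
    (hgl : Tendsto (fun x => g x * l x / x) atTop (𝓝 a)) :
    ∃ M : ℝ, 0 < M ∧ ∀ m n : ℕ, 1 ≤ m → 1 ≤ n → m ≤ 64 * n → n ≤ 64 * m → l m ≤ M * l n := by
  have e1 : ∀ᶠ x in atTop, a / 2 < g x * l x / x :=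
    hgl.eventually (lt_mem_nhds (by linarith))
  have e2 : ∀ᶠ x in atTop, g x * l x / x < 2 * a :=
    hgl.eventually (gt_mem_nhds (by linarith))
  have e3 : ∀ᶠ x in atTop, 1 / 2 < l (64 * x) / l x :=
    (hlsv 64 (by norm_num)).eventually (lt_mem_nhds (by norm_num))
  obtain ⟨X, hX⟩ := eventually_atTop.1 ((e1.and e2).and e3)
  set N0 := ⌈X⌉₊ + 1 with hN0
  have big : ∀ n : ℕ, N0 ≤ n → ∀ y : ℝ, (n:ℝ) ≤ y → 0 < y ∧ 0 < l y ∧ 0 < g y ∧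
      a / 2 * y ≤ g y * l y ∧ g y * l y ≤ 2 * a * y ∧ l y ≤ 2 * l (64 * y) := by
    intro n hn y hy
    have h1 : X ≤ y := by
      have h2 := Nat.le_ceil X
      have h3 : ((⌈X⌉₊ : ℕ):ℝ) ≤ n := by exact_mod_cast (by omega : ⌈X⌉₊ ≤ n)
      linarith
    have h4 : (1:ℝ) ≤ y := by
      have : (1:ℝ) ≤ n := by exact_mod_cast (by omega : 1 ≤ n)
      linarith
    have hy0 : 0 < y := by linarith
    have hl := hlpos y h4
    obtain ⟨⟨a1, a2⟩, a3⟩ := hX y h1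
    rw [lt_div_iff₀ hy0] at a1
    rw [div_lt_iff₀ hy0] at a2
    rw [lt_div_iff₀ hl] at a3
    refine ⟨hy0, hl, ?_, a1.le, a2.le, by linarith⟩
    have : 0 < g y * l y := lt_trans (by positivity) a1
    exact pos_of_mul_pos_left this hl.le
  set A := ∑ i ∈ Finset.Icc 1 (64 * N0), l i with hA
  set B := ∑ i ∈ Finset.Icc 1 (64 * N0), 1 / l i with hB
  have posi : ∀ i ∈ Finset.Icc 1 (64 * N0), 0 < l (i:ℝ) := by
    intro i hi
    exact hlpos _ (by exact_mod_cast (Finset.mem_Icc.1 hi).1)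
  have hA0 : 0 ≤ A := Finset.sum_nonneg (fun i hi => (posi i hi).le)
  have hB0 : 0 ≤ B := Finset.sum_nonneg (fun i hi => by have := posi i hi; positivity)
  refine ⟨2048 + A * B, by positivity, ?_⟩
  intro m n hm hn hmn hnm
  have lm := hlpos m (by exact_mod_cast hm)
  have ln := hlpos n (by exact_mod_cast hn)
  by_cases hbig : N0 ≤ m ∧ N0 ≤ n
  · obtain ⟨b1, b2⟩ := hbig
    obtain ⟨m0, -, gm, m1, m2, m3⟩ := big m b1 m le_rfl
    obtain ⟨n0, -, gn, n1, n2, n3⟩ := big n b2 n le_rfl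
    have hmn' : (m:ℝ) ≤ 64 * n := by exact_mod_cast hmn
    have hnm' : (n:ℝ) ≤ 64 * m := by exact_mod_cast hnm
    suffices l m ≤ 2048 * l n by nlinarith [mul_nonneg (mul_nonneg hA0 hB0) ln.le]
    rcases le_total m n with h | h
    · -- m ≤ n ≤ 64 m
      have h' : (m:ℝ) ≤ n := by exact_mod_cast h
      obtain ⟨q0, lq, gq, q1, q2, -⟩ := big m b1 (64 * m) (by linarith)
      have g1 := hg n (64 * m) n0 hnm'
      -- g(64 m) l(64m) ≤ 128 a m ≤ 256 g m l m
      have h5 : g (64 * m) * l m ≤ 256 * a * m := by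
        calc g (64 * m) * l m ≤ g (64 * m) * (2 * l (64 * m)) := by gcongr
          _ = 2 * (g (64 * m) * l (64 * m)) := by ring
          _ ≤ 2 * (2 * a * (64 * m)) := by gcongr
          _ = _ := by ring
      have h6 : g n * l m ≤ g n * (2048 * l n) := by
        calc g n * l m ≤ g (64 * m) * l m := by gcongr
          _ ≤ 256 * a * m := h5
          _ ≤ 256 * a * n := by gcongr
          _ ≤ 2048 * (a / 2 * n) := by nlinarith [mul_pos ha n0]
          _ ≤ 2048 * (g n * l n) := by gcongr
          _ = _ := by ring
      exact le_of_mul_le_mul_left h6 gn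
    · have h' : (n:ℝ) ≤ m := by exact_mod_cast h
      have g1 := hg n m n0 h'
      have h6 : g n * l m ≤ g n * (2048 * l n) := by
        calc g n * l m ≤ g m * l m := by gcongr
          _ ≤ 2 * a * m := m2
          _ ≤ 2 * a * (64 * n) := by gcongr
          _ ≤ 2048 * (a / 2 * n) := by nlinarith [mul_pos ha n0]
          _ ≤ 2048 * (g n * l n) := by gcongr
          _ = _ := by ring
      exact le_of_mul_le_mul_left h6 gn
  · have hm' : m ∈ Finset.Icc 1 (64 * N0) := Finset.mem_Icc.2 ⟨hm, by omega⟩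
    have hn' : n ∈ Finset.Icc 1 (64 * N0) := Finset.mem_Icc.2 ⟨hn, by omega⟩
    have h1 : l m ≤ A := Finset.single_le_sum (f := fun i : ℕ => l i) (fun i hi => (posi i hi).le) hm'
    have h2 : 1 / l n ≤ B := Finset.single_le_sum (f := fun i : ℕ => 1 / l i)
      (fun i hi => by have := posi i hi; positivity) hn'
    rw [div_le_iff₀ ln] at h2
    have : l m * 1 ≤ A * (B * l n) := mul_le_mul h1 h2 zero_le_one hA0
    nlinarith

lemma seq_growth {u : ℕ → ℝ} (hu : ∀ k, 0 < u k)
    (hr : Tendsto (fun k => u (k+1) / u k) atTop (𝓝 1)) :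
    ∃ C : ℝ, 0 < C ∧ ∀ j i, u (j + i) ≤ C * (3/2) ^ i * u j := by
  have e1 : ∀ᶠ k in atTop, u (k+1) / u k < 3 / 2 :=
    hr.eventually (gt_mem_nhds (by norm_num))
  obtain ⟨k0, hk0⟩ := eventually_atTop.1 e1
  set w : ℕ → ℝ := fun k => u k / (3/2) ^ k with hw
  have hwp : ∀ k, 0 < w k := fun k => by have := hu k; simp only [hw]; positivity
  have hmono : ∀ j i, k0 ≤ j → w (j + i) ≤ w j := by
    intro j i hj
    induction i with
    | zero => simp
    | succ i ih =>
      refine le_trans ?_ ih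
      have := hk0 (j + i) (by omega)
      rw [div_lt_iff₀ (hu _)] at this
      simp only [hw]
      rw [div_le_div_iff₀ (by positivity) (by positivity), ← add_assoc, pow_succ]
      nlinarith [pow_pos (show (0:ℝ) < 3/2 by norm_num) (j + i)]
  set A := ∑ p ∈ Finset.range (k0+1), w p with hA
  set B := ∑ p ∈ Finset.range (k0+1), 1 / w p with hB
  have hA0 : 0 ≤ A := Finset.sum_nonneg (fun p _ => (hwp p).le)
  have hB0 : 0 ≤ B := Finset.sum_nonneg (fun p _ => by have := hwp p; positivity)
  have hwA : ∀ p, w p ≤ A := by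
    intro p
    by_cases hp : p ≤ k0
    · exact Finset.single_le_sum (fun p _ => (hwp p).le) (Finset.mem_range.2 (by omega))
    · obtain ⟨i, rfl⟩ := Nat.exists_eq_add_of_le (show k0 ≤ p by omega)
      exact (hmono k0 i le_rfl).trans
        (Finset.single_le_sum (fun p _ => (hwp p).le) (Finset.mem_range.2 (by omega)))
  refine ⟨1 + A * B, by positivity, ?_⟩
  intro j i
  have key : w (j + i) ≤ (1 + A * B) * w j := by
    have hj := hwp j
    by_cases h : k0 ≤ j
    · have := hmono j i h
      nlinarith [mul_nonneg (mul_nonneg hA0 hB0) hj.le]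
    · have h2 : 1 / w j ≤ B := Finset.single_le_sum (f := fun p => 1 / w p)
        (fun p _ => by have := hwp p; positivity) (Finset.mem_range.2 (by omega))
      rw [div_le_iff₀ hj] at h2
      have : w (j + i) * 1 ≤ A * (B * w j) := mul_le_mul (hwA _) h2 zero_le_one hA0
      nlinarith
  simp only [hw] at key
  rw [div_le_iff₀ (by positivity), pow_add] at key
  refine key.trans (le_of_eq ?_)
  field_simp

/-- summary of the facts about `l` -/
lemma l_facts (l : ℝ → ℝ) (hlsv : SlowlyVarying l) (hlpos : ∀ x, 1 ≤ x → 0 < l x)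
    (ψ₁d : ℝ → ℝ) (hψ₁dpos : ∀ s : ℝ, 0 < s → 0 < ψ₁d s)
    (hψ₁dasymp : Tendsto (fun s => ψ₁d s * (s * l (1 / s)))
      (nhdsWithin 0 (Set.Ioi 0)) (nhds 1))
    (a : ℝ) (ha : 0 < a) (ψ ψd : ℝ → ℝ) (b : ℝ) (ν : Measure ℝ)
    (hrep : IsBernsteinRep ψ 0 b ν)
    (hψderiv : ∀ s : ℝ, 0 < s → HasDerivAt ψ (ψd s) s)
    (hψdasymp : Tendsto (fun s => ψd s / (a * ψ₁d s)) (nhdsWithin 0 (Set.Ioi 0)) (nhds 1)) :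
    (∃ M : ℝ, 0 < M ∧ ∀ m n : ℕ, 1 ≤ m → 1 ≤ n → m ≤ 64 * n → n ≤ 64 * m → l m ≤ M * l n) ∧
    (∃ C : ℝ, 0 < C ∧ ∀ j i : ℕ, l (4 ^ (j + i)) ≤ C * (3/2) ^ i * l (4 ^ j) ∧
      l (4 ^ j) ≤ C * (3/2) ^ i * l (4 ^ (j + i))) := by
  constructor
  · refine sv_pairs hlsv hlpos ha (g := fun x => ψd (1 / x)) ?_ ?_
    · intro x y hx hxy
      have hy : 0 < y := by linarith
      have := (bern_concave hrep).antitoneOn_deriv (fun s hs => (hψderiv s hs).differentiableAt)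
      have h2 := this (show (1 / y) ∈ Set.Ioi (0:ℝ) from one_div_pos.2 hy)
        (show (1 / x) ∈ Set.Ioi (0:ℝ) from one_div_pos.2 hx) (one_div_le_one_div_of_le hx hxy)
      rwa [(hψderiv _ (one_div_pos.2 hy)).deriv, (hψderiv _ (one_div_pos.2 hx)).deriv] at h2
    · have h1 := ((hψdasymp.mul hψ₁dasymp).const_mul a).comp tendsto_inv_atTop_nhdsGT_zero
      simp only [mul_one] at h1
      refine h1.congr' ?_
      filter_upwards [eventually_gt_atTop 0] with x hx
      have := hψ₁dpos x⁻¹ (by positivity)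
      simp only [Function.comp, one_div, inv_inv]
      generalize ψ₁d x⁻¹ = p at this ⊢
      generalize ψd x⁻¹ = q
      field_simp
  · have hu : ∀ k : ℕ, 0 < l (4 ^ k) := fun k => hlpos _ (one_le_pow₀ (by norm_num))
    have h4 : Tendsto (fun k : ℕ => (4:ℝ) ^ k) atTop atTop :=
      tendsto_pow_atTop_atTop_of_one_lt (by norm_num)
    have hr : Tendsto (fun k : ℕ => l (4 ^ (k+1)) / l (4 ^ k)) atTop (𝓝 1) := by
      refine ((hlsv 4 (by norm_num)).comp h4).congr ?_
      intro k
      simp only [Function.comp, pow_succ']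
    obtain ⟨C1, hC1, h1⟩ := seq_growth (u := fun k => l (4 ^ k)) hu hr
    obtain ⟨C2, hC2, h2⟩ := seq_growth (u := fun k => (l (4 ^ k))⁻¹) (fun k => inv_pos.2 (hu k)) (by
      have := hr.inv₀ one_ne_zero
      rw [inv_one] at this
      refine this.congr ?_
      intro k
      rw [inv_div, inv_div_inv])
    refine ⟨C1 + C2, by positivity, ?_⟩
    intro j i
    have p1 := hu j
    have p2 := hu (j + i)
    constructor
    · refine (h1 j i).trans ?_
      gcongr; linarith
    · have h3 := h2 j i
      rw [inv_le_iff_one_le_mul₀ p2] at h3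
      have h4 : l (4 ^ j) ≤ C2 * (3/2) ^ i * l (4 ^ (j + i)) := by
        have := mul_le_mul_of_nonneg_right h3 p1.le
        rw [one_mul] at this
        refine this.trans (le_of_eq ?_)
        field_simp
      refine h4.trans ?_
      gcongr; linarith


lemma cp_le_one {G : Type*} [Group G]
    {φ : G → ℝ} (hF : (Function.support φ).Finite) (hφ : IsSymmProb φ) (n : ℕ) (x : G) :
    convPow φ n x ≤ 1 := by
  rw [← cp_sum hF hφ n]
  exact (fs_summable (cp_fs hF n)).le_tsum x (fun y _ => cp_nonneg hφ n y)

lemma subord_summ {G : Type*} [Group G]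
    {φ : G → ℝ} (hF : (Function.support φ).Finite) (hφ : IsSymmProb φ) {p : ℕ → ℝ}
    (hp : ∀ n, 0 ≤ p n) (hs : Summable p) (x : G) :
    Summable (fun n => p n * convPow φ n x) :=
  hs.of_nonneg_of_le (fun n => mul_nonneg (hp n) (cp_nonneg hφ n x))
    (fun n => mul_le_of_le_one_right (hp n) (cp_le_one hF hφ n x))

/-- the comparison with dyadic scales -/
lemma dyadic {l : ℝ → ℝ} (hlpos : ∀ x, 1 ≤ x → 0 < l x) {M : ℝ} (hM : 0 < M)
    (hpair : ∀ m n : ℕ, 1 ≤ m → 1 ≤ n → m ≤ 64 * n → n ≤ 64 * m → l m ≤ M * l n) (D r : ℕ) :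
    ∃ j : ℕ, 2 ^ j ≤ 1 + r ∧ 1 + r < 2 ^ (j+1) ∧
      (1 + (r:ℝ)) ^ D * l (1 + (r:ℝ) ^ 2) ≤ (2 ^ D * M) * (((2:ℝ) ^ j) ^ D * l (4 ^ j)) ∧
      ((2:ℝ) ^ j) ^ D * l (4 ^ j) ≤ M * ((1 + (r:ℝ)) ^ D * l (1 + (r:ℝ) ^ 2)) := by
  refine ⟨Nat.log 2 (1 + r), Nat.pow_log_le_self 2 (by omega), Nat.lt_pow_succ_log_self (by norm_num) _, ?_⟩
  have h1 : 2 ^ (Nat.log 2 (1 + r)) ≤ 1 + r := Nat.pow_log_le_self 2 (by omega)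
  have h2 : 1 + r < 2 ^ (Nat.log 2 (1 + r) + 1) := Nat.lt_pow_succ_log_self (by norm_num) _
  generalize Nat.log 2 (1 + r) = j at *
  have p4 : 4 ^ j = 2 ^ j * 2 ^ j := by rw [← mul_pow]; norm_num
  rw [pow_succ] at h2
  have g1 : 4 ^ j ≤ 64 * (1 + r ^ 2) := by
    rw [p4]
    refine (Nat.mul_le_mul h1 h1).trans ?_
    have : 2 * r ≤ 1 + r ^ 2 := by zify; nlinarith [sq_nonneg ((r:ℤ) - 1)]
    nlinarith
  have g2 : 1 + r ^ 2 ≤ 64 * 4 ^ j := by rw [p4]; nlinarith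
  have a1 := hpair (4 ^ j) (1 + r ^ 2) (Nat.one_le_pow _ _ (by norm_num)) (by omega) g1 g2
  have a2 := hpair (1 + r ^ 2) (4 ^ j) (by omega) (Nat.one_le_pow _ _ (by norm_num)) g2 g1
  push_cast at a1 a2
  have q1 : 0 < l (4 ^ j) := hlpos _ (one_le_pow₀ (by norm_num))
  have q2 : 0 < l (1 + (r:ℝ) ^ 2) := hlpos _ (by nlinarith)
  have r1 : (2:ℝ) ^ j ≤ 1 + r := by exact_mod_cast h1
  have r2 : 1 + (r:ℝ) ≤ 2 * 2 ^ j := by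
    have : 1 + r ≤ 2 * 2 ^ j := by omega
    exact_mod_cast this
  constructor
  · calc (1 + (r:ℝ)) ^ D * l (1 + (r:ℝ) ^ 2) ≤ (2 * 2 ^ j) ^ D * (M * l (4 ^ j)) := by gcongr
      _ = _ := by rw [mul_pow]; ring
  · calc ((2:ℝ) ^ j) ^ D * l (4 ^ j) ≤ (1 + (r:ℝ)) ^ D * (M * l (1 + (r:ℝ) ^ 2)) := by gcongr
      _ = _ := by ring

lemma lower_bd {G : Type*} [Group G] {S : Set G} (hS : IsSymmGen S) {D : ℕ} (hD : PolyGrowth S D)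
    {φ : G → ℝ} (hF : (Function.support φ).Finite) (hφ : IsSymmProb φ) (hφe : 0 < φ 1)
    (hφgen : Subgroup.closure (Function.support φ) = ⊤)
    {l : ℝ → ℝ} (hlpos : ∀ x, 1 ≤ x → 0 < l x) {M : ℝ} (hM : 0 < M)
    (hpair : ∀ m n : ℕ, 1 ≤ m → 1 ≤ n → m ≤ 64 * n → n ≤ 64 * m → l m ≤ M * l n)
    {C : ℝ} (hC : 0 < C) (hgr : ∀ j i : ℕ, l (4 ^ (j + i)) ≤ C * (3/2) ^ i * l (4 ^ j))
    {p : ℕ → ℝ} (hp : ∀ n, 0 ≤ p n) (hs : Summable p) {cp : ℝ} (hcp : 0 < cp)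
    (hlow : ∀ n : ℕ, 1 ≤ n → cp / ((1 + (n : ℝ)) * l (1 + (n : ℝ))) ≤ p n) :
    ∃ c : ℝ, 0 < c ∧ ∀ x : G,
      c / ((1 + (wordLen S x : ℝ)) ^ D * l (1 + (wordLen S x : ℝ) ^ 2)) ≤ subord φ p x := by
  obtain ⟨ε, c, hε, hc, hk⟩ := hkl hS hD hF hφ hφe hφgen
  obtain ⟨K0, hK0⟩ := pow_unbounded_of_one_lt (2 / ε) (show (1:ℝ) < 2 by norm_num)
  rw [div_lt_iff₀ hε] at hK0
  have hlk : ∀ k : ℕ, 0 < l (4 ^ k) := fun k => hlpos _ (one_le_pow₀ (by norm_num))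
  have step : ∀ k x, (wordLen S x : ℝ) ≤ ε * 2 ^ k →
      cp * c / (9 * M) ≤ subord φ p x * (((2:ℝ) ^ k) ^ D * l (4 ^ k)) := by
    intro k x hx
    set V := ((2:ℝ) ^ k) ^ D with hV
    have hVpos : 0 < V := by positivity
    have hL := hlk k
    have hsum : ∑ n ∈ (Finset.Ico (2 * 4 ^ k) (4 * 4 ^ k)).image (fun q => 2 * q),
        p n * convPow φ n x ≤ subord φ p x :=
      (subord_summ hF hφ hp hs x).sum_le_tsum _ (fun n _ => mul_nonneg (hp n) (cp_nonneg hφ n x))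
    rw [Finset.sum_image (fun a _ b _ h => by simpa using h)] at hsum
    have hterm : ∀ q ∈ Finset.Ico (2 * 4 ^ k) (4 * 4 ^ k),
        cp / (9 * 4 ^ k * (M * l (4 ^ k))) * (c / V) ≤ p (2 * q) * convPow φ (2 * q) x := by
      intro q hq
      rw [Finset.mem_Ico] at hq
      have h4 : 1 ≤ 4 ^ k := Nat.one_le_pow _ _ (by norm_num)
      apply mul_le_mul _ _ (by positivity) (hp _)
      · refine le_trans ?_ (hlow (2 * q) (by omega))
        have h1 := hpair (1 + 2 * q) (4 ^ k) (by omega) h4 (by omega) (by omega)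
        have h2 : (1 + ((2 * q : ℕ):ℝ)) ≤ 9 * 4 ^ k := by
          have : 1 + 2 * q ≤ 9 * 4 ^ k := by omega
          exact_mod_cast this
        have h3 : 0 < l (1 + ((2 * q : ℕ):ℝ)) := hlpos _ (by simp)
        have h1' : l (1 + ((2 * q : ℕ):ℝ)) ≤ M * l (4 ^ k) := by
          push_cast at h1 ⊢; exact h1
        gcongr
      · rw [div_le_iff₀ hVpos]
        exact hk k q x hq.1 hq.2.le hx
    have h5 := Finset.card_nsmul_le_sum _ _ _ hterm
    rw [Nat.card_Ico, nsmul_eq_mul] at h5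
    have h6 : ((4 * 4 ^ k - 2 * 4 ^ k : ℕ) : ℝ) = 2 * 4 ^ k := by
      have : 4 * 4 ^ k - 2 * 4 ^ k = 2 * 4 ^ k := by omega
      rw [this]; push_cast; ring
    rw [h6] at h5
    have h7 := h5.trans hsum
    calc cp * c / (9 * M) ≤ 2 * (cp * c / (9 * M)) := by
          have : 0 ≤ cp * c / (9 * M) := by positivity
          linarith
      _ = (2 * 4 ^ k * (cp / (9 * 4 ^ k * (M * l (4 ^ k))) * (c / V))) * (V * l (4 ^ k)) := by
          field_simp
      _ ≤ _ := mul_le_mul_of_nonneg_right h7 (by positivity)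
  set Q := ((2:ℝ) ^ K0) ^ D * (C * (3/2) ^ K0) * M with hQ
  have hQp : 0 < Q := by positivity
  refine ⟨cp * c / (9 * M) / Q, by positivity, ?_⟩
  intro x
  obtain ⟨j, h1, h2, h3, h4⟩ := dyadic hlpos hM hpair D (wordLen S x)
  set W := (1 + (wordLen S x : ℝ)) ^ D * l (1 + (wordLen S x : ℝ) ^ 2) with hW
  have hWp : 0 < W := by
    have : 0 < l (1 + (wordLen S x : ℝ) ^ 2) := hlpos _ (by nlinarith)
    positivity
  have h5 : (wordLen S x : ℝ) ≤ ε * 2 ^ (j + K0) := by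
    have : wordLen S x ≤ 2 ^ (j+1) := by omega
    have h6 : (wordLen S x : ℝ) ≤ 2 ^ (j+1) := by exact_mod_cast this
    rw [pow_succ] at h6
    rw [pow_add]
    nlinarith [pow_pos (show (0:ℝ) < 2 by norm_num) j]
  have h6 := step _ x h5
  have hsub : 0 ≤ subord φ p x := tsum_nonneg (fun n => mul_nonneg (hp n) (cp_nonneg hφ n x))
  have h7 : ((2:ℝ) ^ (j + K0)) ^ D * l (4 ^ (j + K0)) ≤ Q * W := by
    have hLj := hlk j
    calc _ ≤ ((2:ℝ) ^ (j + K0)) ^ D * (C * (3/2) ^ K0 * l (4 ^ j)) := by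
          gcongr; exact hgr j K0
      _ = ((2:ℝ) ^ K0) ^ D * (C * (3/2) ^ K0) * (((2:ℝ) ^ j) ^ D * l (4 ^ j)) := by
          rw [pow_add, mul_pow]; ring
      _ ≤ ((2:ℝ) ^ K0) ^ D * (C * (3/2) ^ K0) * (M * W) := by gcongr
      _ = _ := by rw [hQ]; ring
  rw [div_div, div_le_iff₀ (by positivity)]
  exact h6.trans (mul_le_mul_of_nonneg_left h7 hsub)

lemma geo_sum (j : ℕ) : ∀ K : ℕ, ∑ k ∈ Finset.range K, ((3:ℝ)/4) ^ ((k - j) + (j - k)) ≤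
    4 + 4 * (1 - (3/4) ^ j) := by
  induction j with
  | zero =>
    intro K
    simp only [Nat.sub_zero, Nat.zero_sub, add_zero, pow_zero, sub_self, mul_zero]
    rw [geom_sum_eq (by norm_num)]
    have : (0:ℝ) < (3/4) ^ K := by positivity
    rw [div_le_iff_of_neg (by norm_num)]
    linarith
  | succ j ih =>
    intro K
    have hp : (0:ℝ) < (3/4) ^ j := by positivity
    have hp1 : ((3:ℝ)/4) ^ j ≤ 1 := pow_le_one₀ (by norm_num) (by norm_num)
    rcases K with _ | K
    · rw [pow_succ]; simp only [Finset.range_zero, Finset.sum_empty]; linarith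
    · rw [Finset.sum_range_succ']
      simp only [Nat.add_sub_add_right, Nat.zero_sub, Nat.sub_zero, zero_add]
      have := ih K
      rw [pow_succ]
      linarith

lemma exp_bd (D : ℕ) (α : ℝ) (hα : 0 < α) : ∃ B : ℝ, 0 < B ∧ ∀ i : ℕ,
    (3/2 : ℝ) ^ i * ((2:ℝ) ^ i) ^ D * Real.exp (-(α * (2 ^ i - 1))) ≤ B * (3/4) ^ i := by
  refine ⟨Real.exp α * ((D+1).factorial / α ^ (D+1)), by positivity, ?_⟩
  intro i
  have h1 := Real.pow_div_factorial_le_exp (α * 2 ^ i) (by positivity) (D+1)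
  have e1 : Real.exp (-(α * (2 ^ i - 1))) = Real.exp α / Real.exp (α * 2 ^ i) := by
    rw [← Real.exp_sub]; congr 1; ring
  have e2 : (3/2 : ℝ) ^ i = (3/4) ^ i * 2 ^ i := by rw [← mul_pow]; norm_num
  rw [e1, e2]
  rw [div_le_iff₀ (by positivity), mul_pow] at h1
  have h2 : ((2:ℝ) ^ i) ^ (D+1) / Real.exp (α * 2 ^ i) ≤ (D+1).factorial / α ^ (D+1) := by
    rw [div_le_div_iff₀ (Real.exp_pos _) (by positivity)]; linarith
  calc _ = (3/4 : ℝ) ^ i * Real.exp α * (((2:ℝ) ^ i) ^ (D+1) / Real.exp (α * 2 ^ i)) := by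
        rw [pow_succ ((2:ℝ) ^ i) D]; ring
    _ ≤ (3/4 : ℝ) ^ i * Real.exp α * ((D+1).factorial / α ^ (D+1)) := by gcongr
    _ = _ := by ring

lemma upper_bd {G : Type*} [Group G] {S : Set G} (hS : IsSymmGen S) {D : ℕ} (hD : PolyGrowth S D)
    (hD1 : 1 ≤ D)
    {φ : G → ℝ} (hF : (Function.support φ).Finite) (hφ : IsSymmProb φ) (hφe : 0 < φ 1)
    (hφgen : Subgroup.closure (Function.support φ) = ⊤)
    {l : ℝ → ℝ} (hlpos : ∀ x, 1 ≤ x → 0 < l x) {M : ℝ} (hM : 0 < M)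
    (hpair : ∀ m n : ℕ, 1 ≤ m → 1 ≤ n → m ≤ 64 * n → n ≤ 64 * m → l m ≤ M * l n)
    {C : ℝ} (hC : 0 < C) (hgr : ∀ j i : ℕ, l (4 ^ (j + i)) ≤ C * (3/2) ^ i * l (4 ^ j) ∧
      l (4 ^ j) ≤ C * (3/2) ^ i * l (4 ^ (j + i)))
    {p : ℕ → ℝ} (hp : ∀ n, 0 ≤ p n) (hp0 : p 0 = 0) {cp : ℝ} (hcp : 0 < cp)
    (hup : ∀ n : ℕ, 1 ≤ n → p n ≤ cp / ((1 + (n : ℝ)) * l (1 + (n : ℝ)))) :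
    ∃ c : ℝ, 0 < c ∧ ∀ x : G, subord φ p x ≤
      c / ((1 + (wordLen S x : ℝ)) ^ D * l (1 + (wordLen S x : ℝ) ^ 2)) := by
  obtain ⟨α, K, hα, hK, hk⟩ := hku hS hD hF hφ hφe hφgen
  obtain ⟨B, hB, hexp⟩ := exp_bd D α hα
  have hlk : ∀ k : ℕ, 0 < l (4 ^ k) := fun k => hlpos _ (one_le_pow₀ (by norm_num))
  -- block bound
  have block : ∀ k x, (∑ n ∈ Finset.Ico (4 ^ k) (4 ^ (k+1)), p n * convPow φ n x) *
      (((2:ℝ) ^ k) ^ D * l (4 ^ k)) ≤ 3 * cp * M * K * Real.exp (-(α * (wordLen S x / 2 ^ k))) := by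
    intro k x
    set V := ((2:ℝ) ^ k) ^ D with hV
    have hVpos : 0 < V := by positivity
    have hL := hlk k
    set E := Real.exp (-(α * (wordLen S x / 2 ^ k))) with hE
    have hEp : 0 < E := Real.exp_pos _
    have hterm : ∀ n ∈ Finset.Ico (4 ^ k) (4 ^ (k+1)),
        p n * convPow φ n x ≤ cp * M / (4 ^ k * l (4 ^ k)) * (K * E / V) := by
      intro n hn
      rw [Finset.mem_Ico] at hn
      have h4 : 1 ≤ 4 ^ k := Nat.one_le_pow _ _ (by norm_num)
      have h4' : 4 ^ (k+1) = 4 * 4 ^ k := by ring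
      apply mul_le_mul _ _ (cp_nonneg hφ _ _) (by positivity)
      · refine (hup n (by omega)).trans ?_
        have h1 := hpair (4 ^ k) (1 + n) h4 (by omega) (by omega) (by omega)
        have h2 : (4:ℝ) ^ k ≤ 1 + n := by
          have : 4 ^ k ≤ 1 + n := by omega
          exact_mod_cast this
        push_cast at h1
        have h3 : 0 < l (1 + (n:ℝ)) := hlpos _ (by simp)
        rw [div_le_div_iff₀ (by positivity) (by positivity)]
        calc cp * (4 ^ k * l (4 ^ k)) ≤ cp * ((1 + n) * (M * l (1 + n))) := by gcongr
          _ = _ := by ring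
      · rw [le_div_iff₀ hVpos]
        exact hk k n x hn.1 hn.2
    have h5 := Finset.sum_le_card_nsmul _ _ _ hterm
    rw [Nat.card_Ico, nsmul_eq_mul] at h5
    have h6 : ((4 ^ (k+1) - 4 ^ k : ℕ) : ℝ) = 3 * 4 ^ k := by
      have : 4 ^ (k+1) - 4 ^ k = 3 * 4 ^ k := by rw [pow_succ]; omega
      rw [this]; push_cast; ring
    rw [h6] at h5
    refine (mul_le_mul_of_nonneg_right h5 (by positivity)).trans (le_of_eq ?_)
    field_simp
  set A := 3 * cp * M * K * (C * (1 + B)) with hA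
  have hAp : 0 < A := by positivity
  refine ⟨A * 8 * (2 ^ D * M), by positivity, ?_⟩
  intro x
  obtain ⟨j, h1, h2, h3, -⟩ := dyadic hlpos hM hpair D (wordLen S x)
  set W := (1 + (wordLen S x : ℝ)) ^ D * l (1 + (wordLen S x : ℝ) ^ 2) with hW
  have hWp : 0 < W := by
    have : 0 < l (1 + (wordLen S x : ℝ) ^ 2) := hlpos _ (by nlinarith)
    positivity
  have hLj := hlk j
  have comp : ∀ k, Real.exp (-(α * (wordLen S x / 2 ^ k))) * (((2:ℝ) ^ j) ^ D * l (4 ^ j)) ≤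
      C * (1 + B) * (3/4) ^ ((k - j) + (j - k)) * (((2:ℝ) ^ k) ^ D * l (4 ^ k)) := by
    intro k
    rcases le_total j k with h | h
    · obtain ⟨i, rfl⟩ := Nat.exists_eq_add_of_le h
      have e1 : (j + i - j) + (j - (j + i)) = i := by omega
      rw [e1]
      have hLk := hlk (j + i)
      have h4 : Real.exp (-(α * (wordLen S x / 2 ^ (j + i)))) ≤ 1 :=
        Real.exp_le_one_iff.2 (by
          have : 0 ≤ α * (wordLen S x / 2 ^ (j + i)) := by positivity
          linarith)
      have h5 : (2:ℝ) ^ i ≤ (2 ^ i) ^ D := le_self_pow₀ (one_le_pow₀ (by norm_num)) (by omega)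
      have e2 : (3/2 : ℝ) ^ i = (3/4) ^ i * 2 ^ i := by rw [← mul_pow]; norm_num
      calc _ ≤ 1 * (((2:ℝ) ^ j) ^ D * (C * (3/2) ^ i * l (4 ^ (j + i)))) := by
            apply mul_le_mul h4 _ (by positivity) zero_le_one
            exact mul_le_mul_of_nonneg_left (hgr j i).2 (by positivity)
        _ = C * (3/4) ^ i * (((2:ℝ) ^ j) ^ D * 2 ^ i * l (4 ^ (j + i))) := by rw [e2]; ring
        _ ≤ C * (3/4) ^ i * (((2:ℝ) ^ j) ^ D * (2 ^ i) ^ D * l (4 ^ (j + i))) := by gcongr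
        _ = C * 1 * (3/4) ^ i * (((2:ℝ) ^ (j + i)) ^ D * l (4 ^ (j + i))) := by
            rw [pow_add (2:ℝ), mul_pow]; ring
        _ ≤ _ := by gcongr; linarith
    · obtain ⟨i, rfl⟩ := Nat.exists_eq_add_of_le h
      have e1 : (k - (k + i)) + (k + i - k) = i := by omega
      rw [e1]
      have hLk := hlk k
      have h4 : Real.exp (-(α * (wordLen S x / 2 ^ k))) ≤ Real.exp (-(α * (2 ^ i - 1))) := by
        apply Real.exp_le_exp.2
        rw [neg_le_neg_iff]
        apply mul_le_mul_of_nonneg_left _ hα.le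
        rw [le_div_iff₀ (by positivity), sub_mul, ← pow_add, add_comm i k]
        have r1 : (2:ℝ) ^ (k + i) ≤ 1 + wordLen S x := by exact_mod_cast h1
        have r2 : (1:ℝ) ≤ 2 ^ k := one_le_pow₀ (by norm_num)
        linarith
      calc _ ≤ Real.exp (-(α * (2 ^ i - 1))) *
            (((2:ℝ) ^ (k + i)) ^ D * (C * (3/2) ^ i * l (4 ^ k))) := by
            apply mul_le_mul h4 _ (by positivity) (Real.exp_pos _).le
            exact mul_le_mul_of_nonneg_left (hgr k i).1 (by positivity)
        _ = C * (((2:ℝ) ^ k) ^ D * l (4 ^ k)) *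
            ((3/2 : ℝ) ^ i * ((2:ℝ) ^ i) ^ D * Real.exp (-(α * (2 ^ i - 1)))) := by
            rw [pow_add, mul_pow]; ring
        _ ≤ C * (((2:ℝ) ^ k) ^ D * l (4 ^ k)) * (B * (3/4) ^ i) :=
            mul_le_mul_of_nonneg_left (hexp i) (by positivity)
        _ = C * B * (3/4) ^ i * (((2:ℝ) ^ k) ^ D * l (4 ^ k)) := by ring
        _ ≤ _ := by gcongr; linarith
  set U := ((2:ℝ) ^ j) ^ D * l (4 ^ j) with hU
  have hUp : 0 < U := by positivity
  have blk2 : ∀ k, ∑ n ∈ Finset.Ico (4 ^ k) (4 ^ (k+1)), p n * convPow φ n x ≤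
      A / U * (3/4) ^ ((k - j) + (j - k)) := by
    intro k
    have hLk := hlk k
    set T := ((2:ℝ) ^ k) ^ D * l (4 ^ k) with hT
    have hTp : 0 < T := by positivity
    have b1 := block k x
    have b2 := comp k
    have b3 : (∑ n ∈ Finset.Ico (4 ^ k) (4 ^ (k+1)), p n * convPow φ n x) * (T * U) ≤
        A / U * (3/4) ^ ((k - j) + (j - k)) * (T * U) := by
      calc _ = ((∑ n ∈ Finset.Ico (4 ^ k) (4 ^ (k+1)), p n * convPow φ n x) * T) * U := by ring
        _ ≤ (3 * cp * M * K * Real.exp (-(α * (wordLen S x / 2 ^ k)))) * U :=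
          mul_le_mul_of_nonneg_right b1 hUp.le
        _ = 3 * cp * M * K * (Real.exp (-(α * (wordLen S x / 2 ^ k))) * U) := by ring
        _ ≤ 3 * cp * M * K * (C * (1 + B) * (3/4) ^ ((k - j) + (j - k)) * T) :=
          mul_le_mul_of_nonneg_left b2 (by positivity)
        _ = _ := by rw [hA]; field_simp
    exact le_of_mul_le_mul_right b3 (by positivity)
  have tot : ∀ N : ℕ, ∑ n ∈ Finset.range (4 ^ N), p n * convPow φ n x ≤
      ∑ k ∈ Finset.range N, A / U * (3/4) ^ ((k - j) + (j - k)) := by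
    intro N
    induction N with
    | zero => simp [hp0]
    | succ N ih =>
      rw [Finset.sum_range_succ, ← Finset.sum_range_add_sum_Ico _
        (Nat.pow_le_pow_right (by norm_num) (Nat.le_succ N) : 4 ^ N ≤ 4 ^ (N+1))]
      exact add_le_add ih (blk2 N)
  have hnn : ∀ n, 0 ≤ p n * convPow φ n x := fun n => mul_nonneg (hp n) (cp_nonneg hφ n x)
  have fin : subord φ p x ≤ A / U * 8 := by
    apply Real.tsum_le_of_sum_range_le hnn
    intro N
    have hN : N ≤ 4 ^ N := (Nat.lt_pow_self (by norm_num)).le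
    refine (Finset.sum_le_sum_of_subset_of_nonneg (Finset.range_subset_range.2 hN)
      (fun n _ _ => hnn n)).trans ((tot N).trans ?_)
    rw [← Finset.mul_sum]
    apply mul_le_mul_of_nonneg_left _ (by positivity)
    have := geo_sum j N
    have : (0:ℝ) < (3/4) ^ j := by positivity
    linarith
  refine fin.trans ?_
  rw [div_mul_eq_mul_div, div_le_div_iff₀ hUp hWp]
  calc A * 8 * W ≤ A * 8 * (2 ^ D * M * U) := by gcongr
    _ = _ := by ring

lemma upper_zero {G : Type*} [Group G] {S : Set G} (hD : PolyGrowth S 0)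
    {φ : G → ℝ} (hF : (Function.support φ).Finite) (hφ : IsSymmProb φ)
    {l : ℝ → ℝ} (hlpos : ∀ x, 1 ≤ x → 0 < l x)
    {p : ℕ → ℝ} (hp : ∀ n, 0 ≤ p n) (hs : Summable p) :
    ∃ c : ℝ, 0 < c ∧ ∀ x : G, subord φ p x ≤
      c / ((1 + (wordLen S x : ℝ)) ^ 0 * l (1 + (wordLen S x : ℝ) ^ 2)) := by
  have hfin : Finite G := by
    by_contra hinf
    rw [not_finite_iff_infinite] at hinf
    have hb := ball_fin hD
    obtain ⟨c, C, hc, hC, h⟩ := hD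
    obtain ⟨T, hT⟩ := Infinite.exists_subset_card_eq G (⌈C⌉₊ + 1)
    set n := T.sup (wordLen S) + 1 with hn
    have h1 := (h n (by omega)).2
    have h2 : T.card ≤ vol S n := by
      unfold vol
      rw [← Set.ncard_coe_finset]
      apply Set.ncard_le_ncard _ (hb n (by omega))
      intro x hx
      have := Finset.le_sup (f := wordLen S) (Finset.mem_coe.1 hx)
      show wordLen S x ≤ n
      omega
    rw [hT] at h2
    have h3 : ((⌈C⌉₊ + 1 : ℕ) : ℝ) ≤ vol S n := by exact_mod_cast h2
    push_cast at h3
    have := Nat.le_ceil C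
    simp only [pow_zero, mul_one] at h1
    linarith
  have := Fintype.ofFinite G
  have hl : ∀ x : G, 0 < l (1 + (wordLen S x : ℝ) ^ 2) := fun x => hlpos _ (by nlinarith)
  set P := ∑' n, p n with hP
  have hP0 : 0 ≤ P := tsum_nonneg hp
  set Q := ∑ x : G, l (1 + (wordLen S x : ℝ) ^ 2) with hQ
  have hQ0 : 0 ≤ Q := Finset.sum_nonneg (fun x _ => (hl x).le)
  refine ⟨(P + 1) * (Q + 1), by positivity, ?_⟩
  intro x
  have h1 : subord φ p x ≤ P :=
    (subord_summ hF hφ hp hs x).tsum_le_tsum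
      (fun n => mul_le_of_le_one_right (hp n) (cp_le_one hF hφ n x)) hs
  have h2 : l (1 + (wordLen S x : ℝ) ^ 2) ≤ Q :=
    Finset.single_le_sum (f := fun x : G => l (1 + (wordLen S x : ℝ) ^ 2))
      (fun x _ => (hl x).le) (Finset.mem_univ x)
  have hlx := hl x
  rw [pow_zero, one_mul, le_div_iff₀ hlx]
  apply mul_le_mul (by linarith) (by linarith) hlx.le (by linarith)


/-- pointwise bounds for the `ψ`-subordinate `φ_ψ` of a finitely supported
symmetric measure `φ` on a group of polynomial growth of degree `D`:
`φ_ψ(x) ≃ 1/((1+|x|)^D ℓ(1+|x|²))`. -/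
theorem statement4
    -- data for ψ₁ and ℓ
    (l : ℝ → ℝ) (hlsv : SlowlyVarying l) (hlpos : ∀ x, 1 ≤ x → 0 < l x)
    (ψ₁ ψ₁d : ℝ → ℝ)
    (hψ₁deriv : ∀ s : ℝ, 0 < s → HasDerivAt ψ₁ (ψ₁d s) s)
    (hψ₁dcont : ContinuousOn ψ₁d (Set.Ioi 0))
    (hψ₁dpos : ∀ s : ℝ, 0 < s → 0 < ψ₁d s)
    (hψ₁zero : Tendsto ψ₁ (nhdsWithin 0 (Set.Ioi 0)) (nhds 0))
    (hψ₁sv : SlowlyVarying (fun x => ψ₁ (1 / x)))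
    (hψ₁dsv : SlowlyVarying (fun x => (1 / x) * ψ₁d (1 / x)))
    (hψ₁dasymp : Tendsto (fun s => ψ₁d s * (s * l (1 / s)))
      (nhdsWithin 0 (Set.Ioi 0)) (nhds 1))
    -- the complete Bernstein function ψ with its representation data
    (a : ℝ) (ha : 0 < a) (ψ ψd : ℝ → ℝ) (b : ℝ) (ν : Measure ℝ)
    (hrep : IsBernsteinRep ψ 0 b ν) (hcb : IsCompleteBernstein ψ) (hψone : ψ 1 = 1)
    (hψasymp : Tendsto (fun s => ψ s / (a * ψ₁ s)) (nhdsWithin 0 (Set.Ioi 0)) (nhds 1))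
    (hψderiv : ∀ s : ℝ, 0 < s → HasDerivAt ψ (ψd s) s)
    (hψdasymp : Tendsto (fun s => ψd s / (a * ψ₁d s)) (nhdsWithin 0 (Set.Ioi 0)) (nhds 1))
    -- so that c(ψ,n) ≃ 1/((1+n)ℓ(1+n))
    (hcoef : ∃ c C : ℝ, 0 < c ∧ 0 < C ∧ ∀ n : ℕ, 1 ≤ n →
      c / ((1 + (n : ℝ)) * l (1 + (n : ℝ))) ≤ cPsi b ν n ∧
      cPsi b ν n ≤ C / ((1 + (n : ℝ)) * l (1 + (n : ℝ))))
    -- the group and the measure φ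
    {G : Type*} [Group G] (S : Set G) (hS : IsSymmGen S) (D : ℕ) (hD : PolyGrowth S D)
    (φ : G → ℝ) (hφ : IsSymmProb φ) (hφfin : (Function.support φ).Finite)
    (hφe : 0 < φ 1) (hφgen : Subgroup.closure (Function.support φ) = ⊤) :
    ∃ c C : ℝ, 0 < c ∧ 0 < C ∧ ∀ x : G,
      c / ((1 + (wordLen S x : ℝ)) ^ D * l (1 + (wordLen S x : ℝ) ^ 2)) ≤
          subord φ (cPsi b ν) x ∧
        subord φ (cPsi b ν) x ≤
          C / ((1 + (wordLen S x : ℝ)) ^ D * l (1 + (wordLen S x : ℝ) ^ 2)) := by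
  obtain ⟨⟨M, hM, hpair⟩, C, hC, hgr⟩ := l_facts l hlsv hlpos ψ₁d hψ₁dpos hψ₁dasymp a ha ψ ψd b ν
    hrep hψderiv hψdasymp
  obtain ⟨hp, hs⟩ := bern_summ hrep
  obtain ⟨c1, C1, hc1, hC1, hco⟩ := hcoef
  obtain ⟨c, hc, hlow⟩ := lower_bd hS hD hφfin hφ hφe hφgen hlpos hM hpair hC
    (fun j i => (hgr j i).1) hp hs hc1 (fun n hn => (hco n hn).1)
  have hupper : ∃ c : ℝ, 0 < c ∧ ∀ x : G, subord φ (cPsi b ν) x ≤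
      c / ((1 + (wordLen S x : ℝ)) ^ D * l (1 + (wordLen S x : ℝ) ^ 2)) := by
    rcases Nat.eq_zero_or_pos D with rfl | hD1
    · exact upper_zero hD hφfin hφ hlpos hp hs
    · exact upper_bd hS hD hD1 hφfin hφ hφe hφgen hlpos hM hpair hC hgr hp (by simp [cPsi]) hC1
        (fun n hn => (hco n hn).2)
  obtain ⟨K, hK, hup⟩ := hupper
  exact ⟨c, K, hc, hK, fun x => ⟨hlow x, hup x⟩⟩
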